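/- Let q₀ > 1 and suppose 𝒦(q₀) < q₁ < q₀/(q₀−1). Let a = a_{q₀,q₁} be the quasi-greedy (q₀,q₁)-expansion of 1/q₁, let b = b_{q₀,q₁} be the quasi-lazy (q₀,q₁)-expansion of 1/(q₀(q₁−1)), and set ℓ = ℓ_{a,b}, r = r_{a,b}. Then s := dim_H 𝒰_{q₀,q₁} satisfies 0 < s < 1, π_{q₀^s,q₁^s}(ℓ) = π_{q₀^s,q₁^s}(r), and π_{q₀^t,q₁^t}(ℓ) ≠ π_{q₀^t,q₁^t}(r) for every t > s. In particular, if a, b ∈ Ω_{a,b}, then π_{q₀^s,q₁^s}(a) = π_{q₀^s,q₁^s}(b) and π_{q₀^t,q₁^t}(a) ≠ π_{q₀^t,q₁^t}(b) for every t > s. -/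

import Mathlib

open Filter Topology

/-- The base corresponding to a digit: `q0` for digit `0` (`false`), `q1` for digit `1` (`true`). -/
noncomputable def qb (q0 q1 : ℝ) (d : Bool) : ℝ := if d then q1 else q0

/-- `piE q0 q1 i = Σ_{k=1}^∞ i_k / (q_{i_1} ⋯ q_{i_k})`, with 0-based indexing. -/
noncomputable def piE (q0 q1 : ℝ) (i : ℕ → Bool) : ℝ :=
  ∑' k : ℕ, (if i k then (1 : ℝ) else 0) / ∏ j ∈ Finset.range (k + 1), qb q0 q1 (i j)

/-- Strict lexicographic order `≺` on binary sequences. -/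
def lexLt (u v : ℕ → Bool) : Prop := ∃ n : ℕ, (∀ m, m < n → u m = v m) ∧ u n < v n

/-- Non-strict lexicographic order `⪯`. -/
def lexLe (u v : ℕ → Bool) : Prop := lexLt u v ∨ u = v

/-- The tail `i_{n+1} i_{n+2} ⋯` of a sequence (0-based: drop the first `n` entries). -/
def shiftTail (i : ℕ → Bool) (n : ℕ) : ℕ → Bool := fun k => i (n + k)

/-- `Omega a b` : sequences none of whose tails lies in the open lexicographic interval `]a,b[`. -/
def Omega (a b : ℕ → Bool) : Set (ℕ → Bool) :=
  {i | ∀ n : ℕ, ¬ (lexLt a (shiftTail i n) ∧ lexLt (shiftTail i n) b)}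

/-- `(a,b) ∈ W` : `a` starts with digit 0, `b` starts with digit 1, and `a, b ∈ Ω_{a,b}`. -/
def memW (a b : ℕ → Bool) : Prop :=
  a 0 = false ∧ b 0 = true ∧ a ∈ Omega a b ∧ b ∈ Omega a b

/-- The set `L_{a,b,n}` of length-`n` prefixes of elements of `Ω_{a,b}`, as a finset. -/
noncomputable def Lwords (a b : ℕ → Bool) (n : ℕ) : Finset (Fin n → Bool) :=
  Set.Finite.toFinset
    (Set.toFinite {w : Fin n → Bool | ∃ i ∈ Omega a b, ∀ k : Fin n, i k.1 = w k})

/-- Topological entropy `h(Ω_{a,b}) = lim_{n→∞} (1/n) log #L_{a,b,n}`; the limit exists by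
subadditivity, hence it coincides with the `limsup` used here. -/
noncomputable def entropy (a b : ℕ → Bool) : ℝ :=
  Filter.limsup (fun n : ℕ => Real.log ((Lwords a b n).card) / n) Filter.atTop

/-- The univoque set `𝒰_{q₀,q₁}` of reals with exactly one `(q₀,q₁)`-expansion. -/
def univoque (q0 q1 : ℝ) : Set ℝ := {x | ∃! i : ℕ → Bool, piE q0 q1 i = x}

/-- The generalized Komornik–Loreti constant
`𝒦(q₀) = inf {q₁ > 1 : 𝒰_{q₀,q₁} is uncountable}`. -/
noncomputable def Kconst (q0 : ℝ) : ℝ := sInf {q1 : ℝ | 1 < q1 ∧ ¬ (univoque q0 q1).Countable}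

/-- `u` is the quasi-greedy `(q₀,q₁)`-expansion of `x`: the lexicographically largest
expansion of `x` not ending with `0^∞`. -/
def quasiGreedy (q0 q1 : ℝ) (x : ℝ) (u : ℕ → Bool) : Prop :=
  piE q0 q1 u = x ∧ (¬ ∃ n : ℕ, ∀ k, n ≤ k → u k = false) ∧
    ∀ v : ℕ → Bool, piE q0 q1 v = x → (¬ ∃ n : ℕ, ∀ k, n ≤ k → v k = false) → lexLe v u

/-- `u` is the quasi-lazy `(q₀,q₁)`-expansion of `x`: the lexicographically smallest
expansion of `x` not ending with `1^∞`. -/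
def quasiLazy (q0 q1 : ℝ) (x : ℝ) (u : ℕ → Bool) : Prop :=
  piE q0 q1 u = x ∧ (¬ ∃ n : ℕ, ∀ k, n ≤ k → u k = true) ∧
    ∀ v : ℕ → Bool, piE q0 q1 v = x → (¬ ∃ n : ℕ, ∀ k, n ≤ k → v k = true) → lexLe u v

/-- `l = ℓ_{a,b}`, the maximum of `{u ∈ Ω_{a,b} : u ⪯ a}`. -/
def isLeftMax (a b l : ℕ → Bool) : Prop :=
  l ∈ Omega a b ∧ lexLe l a ∧ ∀ u ∈ Omega a b, lexLe u a → lexLe u l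

/-- `r = r_{a,b}`, the minimum of `{u ∈ Ω_{a,b} : u ⪰ b}`. -/
def isRightMin (a b r : ℕ → Bool) : Prop :=
  r ∈ Omega a b ∧ lexLe b r ∧ ∀ u ∈ Omega a b, lexLe b u → lexLe r u


/-! ## Part 1 : sequences, words and the lexicographic order -/

/-- Prepend a digit. -/
def scons (d : Bool) (u : ℕ → Bool) : ℕ → Bool := fun n => Nat.casesOn n d u

/-- Drop the first digit. -/
def tl (u : ℕ → Bool) : ℕ → Bool := fun n => u (n + 1)

@[simp] lemma scons_zero (d : Bool) (u : ℕ → Bool) : scons d u 0 = d := rfl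
@[simp] lemma scons_succ (d : Bool) (u : ℕ → Bool) (n : ℕ) : scons d u (n + 1) = u n := rfl
@[simp] lemma tl_scons (d : Bool) (u : ℕ → Bool) : tl (scons d u) = u := rfl
@[simp] lemma tl_apply (u : ℕ → Bool) (n : ℕ) : tl u n = u (n + 1) := rfl

lemma scons_tl (u : ℕ → Bool) : scons (u 0) (tl u) = u := by
  funext n; cases n <;> rfl

lemma scons_tl' {u : ℕ → Bool} {d : Bool} (h : u 0 = d) : scons d (tl u) = u := by
  subst h; exact scons_tl u

/-- Prepend a finite word. -/
def app : List Bool → (ℕ → Bool) → (ℕ → Bool)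
  | [], u => u
  | d :: w, u => scons d (app w u)

@[simp] lemma app_nil (u : ℕ → Bool) : app [] u = u := rfl
@[simp] lemma app_cons (d : Bool) (w : List Bool) (u : ℕ → Bool) :
    app (d :: w) u = scons d (app w u) := rfl

lemma app_append (w z : List Bool) (u : ℕ → Bool) : app (w ++ z) u = app w (app z u) := by
  induction w with
  | nil => rfl
  | cons d w ih => simp [ih]

/-- The prefix of length `n`. -/
def pre : (ℕ → Bool) → ℕ → List Bool
  | _, 0 => []
  | u, n + 1 => u 0 :: pre (tl u) n

@[simp] lemma pre_zero (u : ℕ → Bool) : pre u 0 = [] := rfl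
lemma pre_succ (u : ℕ → Bool) (n : ℕ) : pre u (n + 1) = u 0 :: pre (tl u) n := rfl

@[simp] lemma pre_length (u : ℕ → Bool) (n : ℕ) : (pre u n).length = n := by
  induction n generalizing u with
  | zero => rfl
  | succ n ih => simp [pre_succ, ih]

@[simp] lemma shiftTail_zero (u : ℕ → Bool) : shiftTail u 0 = u := by
  funext k; simp [shiftTail]

lemma shiftTail_succ (u : ℕ → Bool) (n : ℕ) : shiftTail u (n + 1) = shiftTail (tl u) n := by
  funext k; simp only [shiftTail, tl]; congr 1; omega

lemma app_pre (u : ℕ → Bool) (n : ℕ) : app (pre u n) (shiftTail u n) = u := by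
  induction n generalizing u with
  | zero => simp
  | succ n ih => rw [pre_succ, shiftTail_succ, app_cons, ih, scons_tl]

lemma pre_succ' (u : ℕ → Bool) (n : ℕ) : pre u (n + 1) = pre u n ++ [u n] := by
  induction n generalizing u with
  | zero => rfl
  | succ n ih => rw [pre_succ, ih, pre_succ u n]; rfl

lemma app_inj {w : List Bool} {u v : ℕ → Bool} (h : app w u = app w v) : u = v := by
  induction w with
  | nil => exact h
  | cons d w ih => apply ih; simpa using congrArg tl h

/-- A word that is a prefix of `u` is `pre u _`. -/
lemma pre_app (w : List Bool) (v : ℕ → Bool) : pre (app w v) w.length = w := by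
  induction w with
  | nil => rfl
  | cons d w ih => simp [pre_succ, ih]

lemma app_eq_iff (n : ℕ) (u v : ℕ → Bool) : (∃ y, app (pre u n) y = v) ↔ ∀ m < n, u m = v m := by
  induction n generalizing u v with
  | zero => simp
  | succ n ih =>
    constructor
    · rintro ⟨y, hy⟩ m hm
      subst hy
      cases m with
      | zero => rfl
      | succ m =>
        simp only [pre_succ, app_cons, scons_succ]
        exact (ih (tl u) (app (pre (tl u) n) y)).1 ⟨y, rfl⟩ m (by omega)
    · intro h
      obtain ⟨y, hy⟩ := (ih (tl u) (tl v)).2 (fun m hm => h (m + 1) (by omega))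
      refine ⟨y, ?_⟩
      rw [pre_succ, app_cons, hy, h 0 (by omega), scons_tl]

lemma lexLt_iff {u v : ℕ → Bool} : lexLt u v ↔ toLex u < toLex v := Iff.rfl

lemma lexLe_iff {u v : ℕ → Bool} : lexLe u v ↔ toLex u ≤ toLex v := by
  rw [le_iff_lt_or_eq]; exact Iff.rfl

lemma lexLt_trans {u v w : ℕ → Bool} (h : lexLt u v) (h' : lexLt v w) : lexLt u w :=
  lt_trans (lexLt_iff.1 h) (lexLt_iff.1 h')
lemma lexLt_of_lt_of_le {u v w : ℕ → Bool} (h : lexLt u v) (h' : lexLe v w) : lexLt u w :=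
  lt_of_lt_of_le (lexLt_iff.1 h) (lexLe_iff.1 h')
lemma lexLt_of_le_of_lt {u v w : ℕ → Bool} (h : lexLe u v) (h' : lexLt v w) : lexLt u w :=
  lt_of_le_of_lt (lexLe_iff.1 h) (lexLt_iff.1 h')
lemma lexLe_trans {u v w : ℕ → Bool} (h : lexLe u v) (h' : lexLe v w) : lexLe u w :=
  lexLe_iff.2 (le_trans (lexLe_iff.1 h) (lexLe_iff.1 h'))
lemma lexLt_irrefl {u : ℕ → Bool} : ¬ lexLt u u := fun h => lt_irrefl _ (lexLt_iff.1 h)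
lemma not_lexLt {u v : ℕ → Bool} : ¬ lexLt u v ↔ lexLe v u := by
  rw [lexLe_iff]; exact not_lt (a := toLex u) (b := toLex v)
lemma not_lexLe {u v : ℕ → Bool} : ¬ lexLe u v ↔ lexLt v u := by
  rw [lexLe_iff]; exact not_le (a := toLex u) (b := toLex v)
lemma lexLe_refl (u : ℕ → Bool) : lexLe u u := Or.inr rfl
lemma lexLe_antisymm {u v : ℕ → Bool} (h : lexLe u v) (h' : lexLe v u) : u = v :=
  toLex.injective (le_antisymm (lexLe_iff.1 h) (lexLe_iff.1 h'))
lemma lexLt_trichotomy (u v : ℕ → Bool) : lexLt u v ∨ u = v ∨ lexLt v u := by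
  rcases lt_trichotomy (toLex u) (toLex v) with h | h | h
  · exact Or.inl h
  · exact Or.inr (Or.inl (toLex.injective h))
  · exact Or.inr (Or.inr h)

lemma lexLt_of_zero {u v : ℕ → Bool} (hu : u 0 = false) (hv : v 0 = true) : lexLt u v :=
  ⟨0, by simp, by simp [hu, hv]⟩

lemma zero_le_of_lexLe {u v : ℕ → Bool} (h : lexLe u v) : u 0 ≤ v 0 := by
  by_contra hc
  have h1 : u 0 = true ∧ v 0 = false := by revert hc; cases u 0 <;> cases v 0 <;> simp
  exact not_lexLt.2 h (lexLt_of_zero h1.2 h1.1)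

lemma zero_false_of_le {u v : ℕ → Bool} (h : lexLe u v) (hv : v 0 = false) : u 0 = false := by
  have := zero_le_of_lexLe h; rw [hv] at this; revert this; cases u 0 <;> simp
lemma zero_true_of_le {u v : ℕ → Bool} (h : lexLe u v) (hv : u 0 = true) : v 0 = true := by
  have := zero_le_of_lexLe h; rw [hv] at this; revert this; cases v 0 <;> simp

lemma lexLt_scons (d : Bool) (u v : ℕ → Bool) :
    lexLt (scons d u) (scons d v) ↔ lexLt u v := by
  constructor
  · rintro ⟨n, h1, h2⟩
    cases n with
    | zero => simp at h2
    | succ n => exact ⟨n, fun m hm => h1 (m + 1) (by omega), h2⟩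
  · rintro ⟨n, h1, h2⟩
    refine ⟨n + 1, fun m hm => ?_, h2⟩
    cases m with
    | zero => rfl
    | succ m => exact h1 m (by omega)

lemma lexLe_scons (d : Bool) (u v : ℕ → Bool) :
    lexLe (scons d u) (scons d v) ↔ lexLe u v := by
  rw [← not_lexLt, ← not_lexLt, lexLt_scons]

lemma lexLt_app (w : List Bool) (u v : ℕ → Bool) : lexLt (app w u) (app w v) ↔ lexLt u v := by
  induction w with
  | nil => rfl
  | cons d w ih => simp [lexLt_scons, ih]

lemma lexLe_app (w : List Bool) (u v : ℕ → Bool) : lexLe (app w u) (app w v) ↔ lexLe u v := by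
  rw [← not_lexLt, ← not_lexLt, lexLt_app]

lemma lexLt_decomp {u v : ℕ → Bool} (h : lexLt u v) :
    ∃ w u' v', u = app w u' ∧ v = app w v' ∧ u' 0 = false ∧ v' 0 = true := by
  obtain ⟨n, h1, h2⟩ := h
  obtain ⟨y, hy⟩ := (app_eq_iff n u v).2 h1
  refine ⟨pre u n, shiftTail u n, shiftTail v n, (app_pre u n).symm, ?_, ?_, ?_⟩
  · have : pre v n = pre u n := by rw [← hy]; simpa using pre_app (pre u n) y
    rw [← this, app_pre]
  · simp only [shiftTail, add_zero]; revert h2; cases u n <;> cases v n <;> simp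
  · simp only [shiftTail, add_zero]; revert h2; cases u n <;> cases v n <;> simp

lemma ne_decomp {u v : ℕ → Bool} (h : u ≠ v) :
    ∃ w u' v', u = app w u' ∧ v = app w v' ∧ u' 0 ≠ v' 0 := by
  rcases lexLt_trichotomy u v with h1 | h1 | h1
  · obtain ⟨w, u', v', e1, e2, e3, e4⟩ := lexLt_decomp h1
    exact ⟨w, u', v', e1, e2, by simp [e3, e4]⟩
  · exact absurd h1 h
  · obtain ⟨w, u', v', e1, e2, e3, e4⟩ := lexLt_decomp h1
    exact ⟨w, v', u', e2, e1, by simp [e3, e4]⟩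

lemma Omega_scons {a b : ℕ → Bool} (d : Bool) (u : ℕ → Bool) :
    scons d u ∈ Omega a b ↔
      ¬ (lexLt a (scons d u) ∧ lexLt (scons d u) b) ∧ u ∈ Omega a b := by
  constructor
  · intro h
    refine ⟨by simpa using h 0, fun n => ?_⟩
    have := h (n + 1)
    rwa [shiftTail_succ] at this
  · rintro ⟨h1, h2⟩ n
    cases n with
    | zero => simpa using h1
    | succ n => rw [shiftTail_succ]; exact h2 n

lemma Omega_tl {a b u : ℕ → Bool} (h : u ∈ Omega a b) : tl u ∈ Omega a b := by
  rw [← scons_tl u, Omega_scons] at h; exact h.2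

lemma Omega_app {a b u : ℕ → Bool} {w : List Bool} (h : app w u ∈ Omega a b) :
    u ∈ Omega a b := by
  induction w with
  | nil => exact h
  | cons d w ih => exact ih ((Omega_scons _ _).1 h).2

lemma Omega_shift {a b u : ℕ → Bool} (h : u ∈ Omega a b) (n : ℕ) :
    shiftTail u n ∈ Omega a b := by
  rw [← app_pre u n] at h; exact Omega_app h

lemma Omega_le {a b u : ℕ → Bool} (hb : b 0 = true) (h : u ∈ Omega a b) (hu : u 0 = false) :
    lexLe u a := by
  rw [← not_lexLt]
  intro h1
  exact h 0 (by simpa using ⟨h1, lexLt_of_zero hu hb⟩)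

lemma Omega_ge {a b u : ℕ → Bool} (ha : a 0 = false) (h : u ∈ Omega a b) (hu : u 0 = true) :
    lexLe b u := by
  rw [← not_lexLt]
  intro h1
  exact h 0 (by simpa using ⟨lexLt_of_zero ha hu, h1⟩)

lemma Omega_of {a b u : ℕ → Bool}
    (h : ∀ n, lexLe (shiftTail u n) a ∨ lexLe b (shiftTail u n)) : u ∈ Omega a b := by
  rintro n ⟨h1, h2⟩
  rcases h n with h | h
  · exact not_lexLt.2 h h1
  · exact not_lexLt.2 h h2

lemma isOpen_lexLt_right (a : ℕ → Bool) : IsOpen {v | lexLt a v} := by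
  have : {v | lexLt a v} = ⋃ n, ({v | ∀ m, m < n → a m = v m} ∩ {v | a n < v n}) := by
    ext v; simp [lexLt]
  rw [this]
  refine isOpen_iUnion fun n => IsOpen.inter ?_ ?_
  · have : {v : ℕ → Bool | ∀ m, m < n → a m = v m} =
        ⋂ m ∈ Set.Iio n, (fun v : ℕ → Bool => v m) ⁻¹' {x | a m = x} := by ext; simp [eq_comm]
    rw [this]
    exact (Set.finite_Iio n).isOpen_biInter
      fun m _ => (isOpen_discrete _).preimage (continuous_apply m)
  · exact IsOpen.preimage (f := fun v : ℕ → Bool => v n) (continuous_apply n)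
      (isOpen_discrete {x | a n < x})

lemma isOpen_lexLt_left (a : ℕ → Bool) : IsOpen {v | lexLt v a} := by
  have : {v | lexLt v a} = ⋃ n, ({v | ∀ m, m < n → v m = a m} ∩ {v | v n < a n}) := by
    ext v; simp [lexLt]
  rw [this]
  refine isOpen_iUnion fun n => IsOpen.inter ?_ ?_
  · have : {v : ℕ → Bool | ∀ m, m < n → v m = a m} =
        ⋂ m ∈ Set.Iio n, (fun v : ℕ → Bool => v m) ⁻¹' {x | x = a m} := by ext; simp
    rw [this]
    exact (Set.finite_Iio n).isOpen_biInter
      fun m _ => (isOpen_discrete _).preimage (continuous_apply m)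
  · exact IsOpen.preimage (f := fun v : ℕ → Bool => v n) (continuous_apply n)
      (isOpen_discrete {x | x < a n})

lemma isClosed_Omega (a b : ℕ → Bool) : IsClosed (Omega a b) := by
  have : Omega a b = ⋂ n, {i | ¬ (lexLt a (shiftTail i n) ∧ lexLt (shiftTail i n) b)} := by
    ext; simp [Omega]
  rw [this]
  refine isClosed_iInter fun n => ?_
  have hc : Continuous (fun i : ℕ → Bool => shiftTail i n) :=
    continuous_pi fun k => continuous_apply (n + k)
  exact (((isOpen_lexLt_right a).inter (isOpen_lexLt_left b)).preimage hc).isClosed_compl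

lemma isOpen_cyl (w : List Bool) : IsOpen {u : ℕ → Bool | ∃ v, app w v = u} := by
  have : {u : ℕ → Bool | ∃ v, app w v = u} =
      ⋂ m ∈ Set.Iio w.length, (fun v : ℕ → Bool => v m) ⁻¹'
        {x | app w (fun _ => false) m = x} := by
    ext u
    have := app_eq_iff w.length (app w (fun _ => false)) u
    rw [pre_app] at this
    constructor
    · intro h; simpa [eq_comm] using this.1 h
    · intro h; exact this.2 (by simpa [eq_comm] using h)
  rw [this]
  exact (Set.finite_Iio _).isOpen_biInter
      fun m _ => (isOpen_discrete _).preimage (continuous_apply m)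


/-! ## Part 2 : the projection `piE` -/

lemma contraction_bound {A : Type*} (f : A → ℝ) (c : ℝ) (hc0 : 0 ≤ c) (hc : c < 1)
    (hb : ∃ K, ∀ x, f x ≤ K)
    (h : ∀ K, 0 ≤ K → (∀ x, f x ≤ K) → ∀ x, f x ≤ c * K) : ∀ x, f x ≤ 0 := by
  obtain ⟨K, hK⟩ := hb
  have hn : ∀ n : ℕ, ∀ x, f x ≤ c ^ n * |K| := by
    intro n
    induction n with
    | zero => intro x; simpa using (hK x).trans (le_abs_self K)
    | succ n ih =>
      intro x
      have := h (c ^ n * |K|) (by positivity) ih x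
      rw [pow_succ]; linarith
  intro x
  have h0 : Tendsto (fun n : ℕ => c ^ n * |K|) atTop (𝓝 (0 * |K|)) :=
    (tendsto_pow_atTop_nhds_zero_of_lt_one hc0 hc).mul_const _
  rw [zero_mul] at h0
  exact ge_of_tendsto' h0 fun n => hn n x

/-- Weight of a word: the product of inverse bases. -/
noncomputable def Wt (p0 p1 : ℝ) : List Bool → ℝ
  | [] => 1
  | d :: w => (qb p0 p1 d)⁻¹ * Wt p0 p1 w

@[simp] lemma Wt_nil (p0 p1 : ℝ) : Wt p0 p1 [] = 1 := rfl
@[simp] lemma Wt_cons (p0 p1 : ℝ) (d : Bool) (w : List Bool) :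
    Wt p0 p1 (d :: w) = (qb p0 p1 d)⁻¹ * Wt p0 p1 w := rfl
lemma Wt_append (p0 p1 : ℝ) (w z : List Bool) :
    Wt p0 p1 (w ++ z) = Wt p0 p1 w * Wt p0 p1 z := by
  induction w with
  | nil => simp
  | cons d w ih => simp [ih, mul_assoc]

section
variable {p0 p1 : ℝ}

lemma qb_gt (h0 : 1 < p0) (h1 : 1 < p1) (d : Bool) : 1 < qb p0 p1 d := by
  cases d <;> simp [qb, h0, h1]

/-- contraction ratio -/
noncomputable def rho (p0 p1 : ℝ) : ℝ := max p0⁻¹ p1⁻¹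

lemma rho_nonneg (h0 : 1 < p0) : 0 ≤ rho p0 p1 :=
  le_trans (by positivity) (le_max_left _ _)
lemma rho_lt (h0 : 1 < p0) (h1 : 1 < p1) : rho p0 p1 < 1 :=
  max_lt (inv_lt_one_of_one_lt₀ h0) (inv_lt_one_of_one_lt₀ h1)
lemma qb_inv_le (d : Bool) : (qb p0 p1 d)⁻¹ ≤ rho p0 p1 := by
  cases d <;> simp [qb, rho]

lemma Wt_pos (h0 : 1 < p0) (h1 : 1 < p1) (w : List Bool) : 0 < Wt p0 p1 w := by
  induction w with
  | nil => simp
  | cons d w ih => 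
    have := qb_gt h0 h1 d
    simp only [Wt_cons]; positivity

lemma Wt_le (h0 : 1 < p0) (h1 : 1 < p1) (w : List Bool) :
    Wt p0 p1 w ≤ rho p0 p1 ^ w.length := by
  induction w with
  | nil => simp
  | cons d w ih =>
    simp only [Wt_cons, List.length_cons]
    rw [pow_succ']
    exact mul_le_mul (qb_inv_le d) ih (Wt_pos h0 h1 w).le (rho_nonneg h0)

lemma Wt_le_one (h0 : 1 < p0) (h1 : 1 < p1) (w : List Bool) : Wt p0 p1 w ≤ 1 :=
  (Wt_le h0 h1 w).trans (pow_le_one₀ (rho_nonneg h0) (rho_lt h0 h1).le)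

/-- general term of the series -/
noncomputable def term (p0 p1 : ℝ) (i : ℕ → Bool) (k : ℕ) : ℝ :=
  (if i k then (1 : ℝ) else 0) / ∏ j ∈ Finset.range (k + 1), qb p0 p1 (i j)

lemma prod_eq_Wt (i : ℕ → Bool) (k : ℕ) :
    (∏ j ∈ Finset.range k, qb p0 p1 (i j))⁻¹ = Wt p0 p1 (pre i k) := by
  induction k with
  | zero => simp
  | succ k ih => rw [Finset.prod_range_succ, pre_succ', Wt_append, ← ih]; simp [mul_comm]

lemma term_eq (i : ℕ → Bool) (k : ℕ) :
    term p0 p1 i k = (if i k then (1 : ℝ) else 0) * Wt p0 p1 (pre i (k + 1)) := by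
  rw [term, div_eq_mul_inv, prod_eq_Wt]

lemma term_nonneg (h0 : 1 < p0) (h1 : 1 < p1) (i : ℕ → Bool) (k : ℕ) :
    0 ≤ term p0 p1 i k := by
  rw [term_eq]
  have := Wt_pos h0 h1 (pre i (k + 1))
  split_ifs <;> simp [this.le]

lemma term_le (h0 : 1 < p0) (h1 : 1 < p1) (i : ℕ → Bool) (k : ℕ) :
    term p0 p1 i k ≤ rho p0 p1 ^ (k + 1) := by
  rw [term_eq]
  have h := Wt_le h0 h1 (pre i (k + 1))
  have h' := Wt_pos h0 h1 (pre i (k + 1))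
  rw [pre_length] at h
  split_ifs <;> simp <;> linarith

lemma geo_summable (h0 : 1 < p0) (h1 : 1 < p1) :
    Summable (fun k : ℕ => rho p0 p1 ^ (k + 1)) := by
  have := summable_geometric_of_lt_one (rho_nonneg (p1 := p1) h0) (rho_lt h0 h1)
  exact (summable_nat_add_iff 1).2 this

lemma term_summable (h0 : 1 < p0) (h1 : 1 < p1) (i : ℕ → Bool) :
    Summable (term p0 p1 i) :=
  Summable.of_nonneg_of_le (term_nonneg h0 h1 i) (term_le h0 h1 i) (geo_summable h0 h1)

lemma piE_eq (i : ℕ → Bool) : piE p0 p1 i = ∑' k, term p0 p1 i k := rfl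

lemma piE_nonneg (h0 : 1 < p0) (h1 : 1 < p1) (i : ℕ → Bool) : 0 ≤ piE p0 p1 i :=
  tsum_nonneg (term_nonneg h0 h1 i)

lemma piE_scons (h0 : 1 < p0) (h1 : 1 < p1) (d : Bool) (u : ℕ → Bool) :
    piE p0 p1 (scons d u) = (qb p0 p1 d)⁻¹ * ((if d then 1 else 0) + piE p0 p1 u) := by
  rw [piE_eq, (term_summable h0 h1 _).tsum_eq_zero_add, piE_eq, mul_add, ← tsum_mul_left]
  congr 1
  · rw [term_eq]; simp [pre_succ]; cases d <;> simp
  · congr 1; funext k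
    rw [term_eq, term_eq]
    simp only [pre_succ _ (k + 1), scons_succ, tl_scons, scons_zero, Wt_cons]
    by_cases h : u k = true <;> simp [h]

lemma piE_false (h0 : 1 < p0) (h1 : 1 < p1) (u : ℕ → Bool) :
    piE p0 p1 (scons false u) = p0⁻¹ * piE p0 p1 u := by
  rw [piE_scons h0 h1]; simp [qb]
lemma piE_true (h0 : 1 < p0) (h1 : 1 < p1) (u : ℕ → Bool) :
    piE p0 p1 (scons true u) = p1⁻¹ * (1 + piE p0 p1 u) := by
  rw [piE_scons h0 h1]; simp [qb]

lemma piE_app_sub (h0 : 1 < p0) (h1 : 1 < p1) (w : List Bool) (u v : ℕ → Bool) :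
    piE p0 p1 (app w u) - piE p0 p1 (app w v)
      = Wt p0 p1 w * (piE p0 p1 u - piE p0 p1 v) := by
  induction w with
  | nil => simp
  | cons d w ih =>
    rw [app_cons, app_cons, piE_scons h0 h1, piE_scons h0 h1, Wt_cons, mul_assoc, ← ih]
    ring

lemma piE_le (h0 : 1 < p0) (h1 : 1 < p1) (u : ℕ → Bool) : piE p0 p1 u ≤ 1 / (p1 - 1) := by
  have hp1 : 0 < p1 - 1 := by linarith
  have key := contraction_bound (fun u => piE p0 p1 u - 1 / (p1 - 1)) (rho p0 p1)
    (rho_nonneg h0) (rho_lt h0 h1)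
    ⟨∑' k : ℕ, rho p0 p1 ^ (k + 1), fun u => by
      have h := (term_summable h0 h1 u).tsum_le_tsum (term_le h0 h1 u) (geo_summable h0 h1)
      have : 0 < 1 / (p1 - 1) := by positivity
      simp only [piE_eq]; linarith⟩
    (fun K hK hb u => by
      have hu := hb (tl u)
      have hr := rho_nonneg (p1 := p1) h0
      have hcc : 0 < 1 / (p1 - 1) := by positivity
      have hc2 : p1⁻¹ * (1 + 1 / (p1 - 1)) = 1 / (p1 - 1) := by field_simp; ring
      cases hd : u 0 with
      | false =>
        rw [← scons_tl' hd, piE_false h0 h1]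
        have e1 : p0⁻¹ ≤ rho p0 p1 := le_max_left _ _
        have e2 : p0⁻¹ < 1 := inv_lt_one_of_one_lt₀ h0
        have e3 : 0 < p0⁻¹ := by positivity
        have e4 : p0⁻¹ * piE p0 p1 (tl u) ≤ p0⁻¹ * (1 / (p1 - 1) + K) :=
          mul_le_mul_of_nonneg_left (by linarith) e3.le
        nlinarith [mul_le_mul_of_nonneg_right e1 hK]
      | true =>
        rw [← scons_tl' hd, piE_true h0 h1]
        have e1 : p1⁻¹ ≤ rho p0 p1 := le_max_right _ _
        have e3 : 0 < p1⁻¹ := by positivity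
        have e4 : p1⁻¹ * (1 + piE p0 p1 (tl u)) ≤ p1⁻¹ * (1 + (1 / (p1 - 1) + K)) :=
          mul_le_mul_of_nonneg_left (by linarith) e3.le
        nlinarith [mul_le_mul_of_nonneg_right e1 hK])
  linarith [key u]

lemma piE_allTrue (h0 : 1 < p0) (h1 : 1 < p1) : piE p0 p1 (fun _ => true) = 1 / (p1 - 1) := by
  have h := piE_true h0 h1 (fun _ => true)
  rw [show scons true (fun _ => true) = fun _ => true from scons_tl' (u := fun _ => true) rfl] at h
  have hp1 : 0 < p1 - 1 := by linarith
  field_simp at h ⊢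
  linarith

lemma piE_allFalse : piE p0 p1 (fun _ => false) = 0 := by
  simp [piE]

lemma head_of_piE_zero (h0 : 1 < p0) (h1 : 1 < p1) {u : ℕ → Bool} (h : piE p0 p1 u = 0) :
    u 0 = false ∧ piE p0 p1 (tl u) = 0 := by
  have hn := piE_nonneg h0 h1 (tl u)
  cases hd : u 0 with
  | false =>
    rw [← scons_tl' hd, piE_false h0 h1] at h
    refine ⟨rfl, ?_⟩
    have : p0⁻¹ ≠ 0 := by positivity
    exact (mul_eq_zero.1 h).resolve_left this
  | true =>
    rw [← scons_tl' hd, piE_true h0 h1] at h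
    have : 0 < p1⁻¹ * (1 + piE p0 p1 (tl u)) := by positivity
    linarith

lemma eq_of_piE_zero (h0 : 1 < p0) (h1 : 1 < p1) {u : ℕ → Bool} (h : piE p0 p1 u = 0) (n : ℕ) :
    u n = false := by
  induction n generalizing u with
  | zero => exact (head_of_piE_zero h0 h1 h).1
  | succ n ih => exact ih (head_of_piE_zero h0 h1 h).2

lemma head_of_piE_max (h0 : 1 < p0) (h1 : 1 < p1) {u : ℕ → Bool}
    (h : piE p0 p1 u = 1 / (p1 - 1)) : u 0 = true ∧ piE p0 p1 (tl u) = 1 / (p1 - 1) := by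
  have hn := piE_le h0 h1 (tl u)
  have hp1 : 0 < p1 - 1 := by linarith
  have hcc : 0 < 1 / (p1 - 1) := by positivity
  cases hd : u 0 with
  | false =>
    rw [← scons_tl' hd, piE_false h0 h1] at h
    have e2 : p0⁻¹ < 1 := inv_lt_one_of_one_lt₀ h0
    have e3 : 0 < p0⁻¹ := by positivity
    nlinarith
  | true =>
    rw [← scons_tl' hd, piE_true h0 h1] at h
    refine ⟨rfl, ?_⟩
    have : 1 + piE p0 p1 (tl u) = p1 * (1 / (p1 - 1)) := by
      rw [← h]; field_simp
    have h3 : p1 * (1 / (p1 - 1)) = 1 + 1 / (p1 - 1) := by field_simp; ring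
    linarith

lemma eq_of_piE_max (h0 : 1 < p0) (h1 : 1 < p1) {u : ℕ → Bool}
    (h : piE p0 p1 u = 1 / (p1 - 1)) (n : ℕ) : u n = true := by
  induction n generalizing u with
  | zero => exact (head_of_piE_max h0 h1 h).1
  | succ n ih => exact ih (head_of_piE_max h0 h1 h).2

/-- values of sequences starting with `1` are at least `1/p1` -/
lemma piE_ge_of_true (h0 : 1 < p0) (h1 : 1 < p1) {u : ℕ → Bool} (hu : u 0 = true) :
    1 / p1 ≤ piE p0 p1 u := by
  rw [← scons_tl' hu, piE_true h0 h1, one_div]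
  have := piE_nonneg h0 h1 (tl u)
  have : 0 < p1⁻¹ := by positivity
  nlinarith

lemma piE_le_of_false (h0 : 1 < p0) (h1 : 1 < p1) {u : ℕ → Bool} (hu : u 0 = false) :
    piE p0 p1 u ≤ 1 / (p0 * (p1 - 1)) := by
  rw [← scons_tl' hu, piE_false h0 h1]
  have h2 := piE_le h0 h1 (tl u)
  have hp1 : 0 < p1 - 1 := by linarith
  have : 1 / (p0 * (p1 - 1)) = p0⁻¹ * (1 / (p1 - 1)) := by field_simp
  rw [this]
  gcongr

lemma continuous_piE (h0 : 1 < p0) (h1 : 1 < p1) : Continuous (piE p0 p1) := by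
  have : piE p0 p1 = fun i => ∑' k, term p0 p1 i k := rfl
  rw [this]
  refine continuous_tsum (u := fun k => rho p0 p1 ^ (k + 1)) ?_ (geo_summable h0 h1) ?_
  · intro k
    unfold term
    have hq : Continuous (fun d : Bool => qb p0 p1 d) := continuous_of_discreteTopology
    have hi : Continuous (fun d : Bool => if d then (1 : ℝ) else 0) :=
      continuous_of_discreteTopology
    refine Continuous.div (hi.comp (continuous_apply k)) ?_ ?_
    · exact continuous_finsetProd _ fun j _ => hq.comp (continuous_apply j)
    · intro i
      refine Finset.prod_ne_zero_iff.2 fun j _ => ?_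
      have := qb_gt h0 h1 (i j); positivity
  · intro k i
    rw [Real.norm_of_nonneg (term_nonneg h0 h1 i k)]
    exact term_le h0 h1 i k

lemma Wt_rpow (h0 : 1 < p0) (h1 : 1 < p1) (t : ℝ) (w : List Bool) :
    Wt (p0 ^ t) (p1 ^ t) w = Wt p0 p1 w ^ t := by
  induction w with
  | nil => simp
  | cons d w ih =>
    have := qb_gt h0 h1 d
    rw [Wt_cons, Wt_cons, Real.mul_rpow (by positivity) (Wt_pos h0 h1 w).le, ih,
      Real.inv_rpow (by positivity)]
    cases d <;> simp [qb]

lemma continuousAt_piE_rpow (h0 : 1 < p0) (h1 : 1 < p1) {s : ℝ} (hs : 0 < s) (u : ℕ → Bool) :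
    ContinuousAt (fun t : ℝ => piE (p0 ^ t) (p1 ^ t) u) s := by
  have hs2 : 0 < s / 2 := by linarith
  have g0 : 1 < p0 ^ (s / 2) := Real.one_lt_rpow h0 hs2
  have g1 : 1 < p1 ^ (s / 2) := Real.one_lt_rpow h1 hs2
  have key : ContinuousOn (fun t : ℝ => ∑' k, term (p0 ^ t) (p1 ^ t) u k) (Set.Ici (s / 2)) := by
    refine continuousOn_tsum (u := fun k => rho (p0 ^ (s / 2)) (p1 ^ (s / 2)) ^ (k + 1)) ?_
      (geo_summable g0 g1) ?_
    · intro k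
      have : (fun t : ℝ => term (p0 ^ t) (p1 ^ t) u k) =
          fun t => (if u k then (1 : ℝ) else 0) * Wt p0 p1 (pre u (k + 1)) ^ t := by
        funext t; rw [term_eq, Wt_rpow h0 h1]
      rw [this]
      exact (continuous_const.mul
        (Real.continuous_const_rpow (Wt_pos h0 h1 _).ne')).continuousOn
    · intro k t ht
      have ht' : s / 2 ≤ t := ht
      have ht0 : 0 < t := by linarith
      have k0 : 1 < p0 ^ t := Real.one_lt_rpow h0 ht0
      have k1 : 1 < p1 ^ t := Real.one_lt_rpow h1 ht0
      rw [Real.norm_of_nonneg (term_nonneg k0 k1 u k)]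
      refine (term_le k0 k1 u k).trans ?_
      refine pow_le_pow_left₀ (rho_nonneg k0) ?_ _
      have e0 : p0 ^ (s / 2) ≤ p0 ^ t := Real.rpow_le_rpow_of_exponent_le h0.le ht'
      have e1 : p1 ^ (s / 2) ≤ p1 ^ t := Real.rpow_le_rpow_of_exponent_le h1.le ht'
      exact max_le_max (inv_anti₀ (by linarith) e0) (inv_anti₀ (by linarith) e1)
  exact key.continuousAt (Ici_mem_nhds (by linarith))

end


/-! ## Part 3 : language, branching words, kneading identity -/

/-- `l`, `r` are the extremal elements of the shift space `Omega l r`. -/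
structure KN (l r : ℕ → Bool) : Prop where
  l0 : l 0 = false
  r0 : r 0 = true
  lm : l ∈ Omega l r
  rm : r ∈ Omega l r

/-- `w` is a word of the language of `Omega l r`. -/
def inL (l r : ℕ → Bool) (w : List Bool) : Prop := ∃ u, app w u ∈ Omega l r

/-- `w` is a branching word. -/
def Br (l r : ℕ → Bool) (w : List Bool) : Prop :=
  inL l r (w ++ [false]) ∧ inL l r (w ++ [true])

lemma inL_of_append {l r : ℕ → Bool} {w z : List Bool} (h : inL l r (w ++ z)) : inL l r w := by
  obtain ⟨u, hu⟩ := h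
  exact ⟨app z u, by rwa [← app_append]⟩

lemma inL_of_append_right {l r : ℕ → Bool} {w z : List Bool} (h : inL l r (w ++ z)) :
    inL l r z := by
  obtain ⟨u, hu⟩ := h
  rw [app_append] at hu
  exact ⟨u, Omega_app hu⟩

lemma inL_of_Br {l r : ℕ → Bool} {w : List Bool} (h : Br l r w) : inL l r w :=
  inL_of_append h.1

lemma branch_aux {l r : ℕ → Bool} (hk : KN l r) {w : List Bool} {u v : ℕ → Bool}
    (hu : app w u ∈ Omega l r) (hv : app w v ∈ Omega l r) (u0 : u 0 = false) (v0 : v 0 = true) :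
    app w l ∈ Omega l r ∧ app w r ∈ Omega l r := by
  induction w with
  | nil => exact ⟨hk.lm, hk.rm⟩
  | cons d w ih =>
    have hu' := ((Omega_scons _ _).1 hu).2
    have hv' := ((Omega_scons _ _).1 hv).2
    obtain ⟨i1, i2⟩ := ih hu' hv'
    have ul : lexLe u l := Omega_le hk.r0 (Omega_app hu') u0
    have rv : lexLe r v := Omega_ge hk.l0 (Omega_app hv') v0
    simp only [app_cons] at hu hv ⊢
    rw [Omega_scons, Omega_scons]
    refine ⟨⟨?_, i1⟩, ⟨?_, i2⟩⟩
    · rintro ⟨h1, h2⟩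
      cases d with
      | false =>
        have h3 := Omega_le hk.r0 hv rfl
        have h4 : lexLt (scons false (app w l)) (scons false (app w v)) := by
          rw [lexLt_scons, lexLt_app]; exact lexLt_of_zero hk.l0 v0
        exact lexLt_irrefl (lexLt_trans h1 (lexLt_of_lt_of_le h4 h3))
      | true =>
        have h3 := Omega_ge hk.l0 hu rfl
        have h4 : lexLe (scons true (app w u)) (scons true (app w l)) := by
          rw [lexLe_scons, lexLe_app]; exact ul
        exact not_lexLt.2 (lexLe_trans h3 h4) h2
    · rintro ⟨h1, h2⟩
      cases d with
      | false =>
        have h3 := Omega_le hk.r0 hv rfl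
        have h4 : lexLe (scons false (app w r)) (scons false (app w v)) := by
          rw [lexLe_scons, lexLe_app]; exact rv
        exact not_lexLt.2 (lexLe_trans h4 h3) h1
      | true =>
        have h3 := Omega_ge hk.l0 hu rfl
        have h4 : lexLt (scons true (app w u)) (scons true (app w r)) := by
          rw [lexLt_scons, lexLt_app]; exact lexLt_of_zero u0 hk.r0
        exact lexLt_irrefl (lexLt_trans h2 (lexLt_of_le_of_lt h3 h4))

lemma branch {l r : ℕ → Bool} (hk : KN l r) {w : List Bool} (h : Br l r w) :
    app w l ∈ Omega l r ∧ app w r ∈ Omega l r := by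
  obtain ⟨⟨u, hu⟩, v, hv⟩ := h
  rw [app_append] at hu hv
  exact branch_aux hk hu hv rfl rfl

/-- All words of length `n`. -/
def words : ℕ → Finset (List Bool)
  | 0 => {[]}
  | n + 1 => (words n).image (List.cons false) ∪ (words n).image (List.cons true)

lemma mem_words {n : ℕ} {w : List Bool} : w ∈ words n ↔ w.length = n := by
  induction n generalizing w with
  | zero => simp [words]
  | succ n ih =>
    cases w with
    | nil => simp [words]
    | cons d w => cases d <;> simp [words, ih]

lemma sum_words_succ (n : ℕ) (f : List Bool → ℝ) :
    ∑ z ∈ words (n + 1), f z = ∑ z ∈ words n, f (false :: z) + ∑ z ∈ words n, f (true :: z) := by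
  rw [words, Finset.sum_union, Finset.sum_image, Finset.sum_image]
  · intro x _ y _ h; simpa using h
  · intro x _ y _ h; simpa using h
  · rw [Finset.disjoint_left]
    intro x hx hy
    simp only [Finset.mem_image] at hx hy
    obtain ⟨_, _, rfl⟩ := hx
    obtain ⟨_, _, h⟩ := hy
    simp at h

open Classical in
/-- weight of `w` if `P w`, else `0` -/
noncomputable def fP (P : List Bool → Prop) (p0 p1 : ℝ) (w : List Bool) : ℝ :=
  if P w then Wt p0 p1 w else 0

/-- level sums -/
noncomputable def lv (P : List Bool → Prop) (p0 p1 : ℝ) (n : ℕ) (w : List Bool) : ℝ :=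
  ∑ z ∈ words n, fP P p0 p1 (w ++ z)

/-- sums up to a level -/
noncomputable def sm (P : List Bool → Prop) (p0 p1 : ℝ) (n : ℕ) (w : List Bool) : ℝ :=
  ∑ k ∈ Finset.range n, lv P p0 p1 k w

lemma lv_zero (P : List Bool → Prop) (p0 p1 : ℝ) (w : List Bool) :
    lv P p0 p1 0 w = fP P p0 p1 w := by
  simp [lv, words]

lemma lv_succ (P : List Bool → Prop) (p0 p1 : ℝ) (n : ℕ) (w : List Bool) :
    lv P p0 p1 (n + 1) w = lv P p0 p1 n (w ++ [false]) + lv P p0 p1 n (w ++ [true]) := by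
  simp [lv, sum_words_succ]

lemma sm_zero (P : List Bool → Prop) (p0 p1 : ℝ) (w : List Bool) : sm P p0 p1 0 w = 0 := by
  simp [sm]

lemma sm_succ (P : List Bool → Prop) (p0 p1 : ℝ) (n : ℕ) (w : List Bool) :
    sm P p0 p1 (n + 1) w = fP P p0 p1 w
      + (sm P p0 p1 n (w ++ [false]) + sm P p0 p1 n (w ++ [true])) := by
  simp only [sm, Finset.sum_range_succ', lv_zero, lv_succ, Finset.sum_add_distrib]
  ring

lemma fP_nonneg {p0 p1 : ℝ} (h0 : 1 < p0) (h1 : 1 < p1) (P : List Bool → Prop) (w : List Bool) :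
    0 ≤ fP P p0 p1 w := by
  unfold fP; split_ifs
  · exact (Wt_pos h0 h1 w).le
  · exact le_rfl

lemma lv_nonneg {p0 p1 : ℝ} (h0 : 1 < p0) (h1 : 1 < p1) (P : List Bool → Prop) (n : ℕ)
    (w : List Bool) : 0 ≤ lv P p0 p1 n w :=
  Finset.sum_nonneg fun z _ => fP_nonneg h0 h1 P _

lemma sm_mono {p0 p1 : ℝ} (h0 : 1 < p0) (h1 : 1 < p1) (P : List Bool → Prop) {m n : ℕ}
    (hmn : m ≤ n) (w : List Bool) : sm P p0 p1 m w ≤ sm P p0 p1 n w :=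
  Finset.sum_le_sum_of_subset_of_nonneg (Finset.range_mono hmn)
    fun k _ _ => lv_nonneg h0 h1 P k w

lemma lv_eq_zero {l r : ℕ → Bool} {p0 p1 : ℝ} {n : ℕ} {w : List Bool} (h : ¬ inL l r w) :
    lv (inL l r) p0 p1 n w = 0 :=
  Finset.sum_eq_zero fun z _ => by
    unfold fP; rw [if_neg]; exact fun hc => h (inL_of_append hc)

lemma sm_eq_zero {l r : ℕ → Bool} {p0 p1 : ℝ} {n : ℕ} {w : List Bool} (h : ¬ inL l r w) :
    sm (Br l r) p0 p1 n w = 0 :=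
  Finset.sum_eq_zero fun k _ => Finset.sum_eq_zero fun z _ => by
    unfold fP; rw [if_neg]; exact fun hc => h (inL_of_append (inL_of_Br hc))

/-- `u` is the minimal continuation of `w` -/
def isMn (l r : ℕ → Bool) (w : List Bool) (u : ℕ → Bool) : Prop :=
  app w u ∈ Omega l r ∧ ∀ v, app w v ∈ Omega l r → lexLe u v
/-- `u` is the maximal continuation of `w` -/
def isMx (l r : ℕ → Bool) (w : List Bool) (u : ℕ → Bool) : Prop :=
  app w u ∈ Omega l r ∧ ∀ v, app w v ∈ Omega l r → lexLe v u

lemma isMn_tl {l r : ℕ → Bool} {w : List Bool} {u : ℕ → Bool} (h : isMn l r w u) {d : Bool}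
    (hd : u 0 = d) : isMn l r (w ++ [d]) (tl u) := by
  refine ⟨?_, fun v hv => ?_⟩
  · rw [app_append, app_cons, app_nil, scons_tl' hd]; exact h.1
  · rw [app_append] at hv
    have := h.2 _ hv
    rw [← scons_tl' hd, app_cons, app_nil, lexLe_scons] at this
    exact this

lemma isMx_tl {l r : ℕ → Bool} {w : List Bool} {u : ℕ → Bool} (h : isMx l r w u) {d : Bool}
    (hd : u 0 = d) : isMx l r (w ++ [d]) (tl u) := by
  refine ⟨?_, fun v hv => ?_⟩
  · rw [app_append, app_cons, app_nil, scons_tl' hd]; exact h.1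
  · rw [app_append] at hv
    have := h.2 _ hv
    rw [← scons_tl' hd, app_cons, app_nil, lexLe_scons] at this
    exact this

lemma isMx_l {l r : ℕ → Bool} (hk : KN l r) {w : List Bool} (h : Br l r w) :
    isMx l r (w ++ [false]) (tl l) := by
  refine ⟨?_, fun v hv => ?_⟩
  · rw [app_append, app_cons, app_nil, scons_tl' hk.l0]; exact (branch hk h).1
  · rw [app_append] at hv
    have := Omega_le hk.r0 (Omega_app hv) rfl
    rw [← scons_tl' hk.l0, app_cons, app_nil, lexLe_scons] at this
    exact this

lemma isMn_r {l r : ℕ → Bool} (hk : KN l r) {w : List Bool} (h : Br l r w) :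
    isMn l r (w ++ [true]) (tl r) := by
  refine ⟨?_, fun v hv => ?_⟩
  · rw [app_append, app_cons, app_nil, scons_tl' hk.r0]; exact (branch hk h).2
  · rw [app_append] at hv
    have := Omega_ge hk.l0 (Omega_app hv) rfl
    rw [← scons_tl' hk.r0, app_cons, app_nil, lexLe_scons] at this
    exact this

lemma Wt_tl_sub {p0 p1 : ℝ} (h0 : 1 < p0) (h1 : 1 < p1) {w : List Bool} {u v : ℕ → Bool}
    {d : Bool} (hu : u 0 = d) (hv : v 0 = d) :
    Wt p0 p1 (w ++ [d]) * (piE p0 p1 (tl v) - piE p0 p1 (tl u))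
      = Wt p0 p1 w * (piE p0 p1 v - piE p0 p1 u) := by
  rw [← piE_app_sub h0 h1, ← piE_app_sub h0 h1, app_append, app_append]
  simp only [app_cons, app_nil, scons_tl' hu, scons_tl' hv]

lemma kneading {l r : ℕ → Bool} (hk : KN l r) {p0 p1 : ℝ} (h0 : 1 < p0) (h1 : 1 < p1)
    {lo hi : ℝ}
    (hlo : ∀ u v, u ∈ Omega l r → v ∈ Omega l r → lexLe u v → lo ≤ piE p0 p1 v - piE p0 p1 u)
    (hhi : ∀ u v, u ∈ Omega l r → v ∈ Omega l r → lexLe u v → piE p0 p1 v - piE p0 p1 u ≤ hi)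
    (n : ℕ) {w : List Bool} {u v : ℕ → Bool} (hu : isMn l r w u) (hv : isMx l r w v) :
    lo * lv (inL l r) p0 p1 n w ≤ Wt p0 p1 w * (piE p0 p1 v - piE p0 p1 u)
        - (piE p0 p1 r - piE p0 p1 l) * sm (Br l r) p0 p1 n w ∧
    Wt p0 p1 w * (piE p0 p1 v - piE p0 p1 u)
        - (piE p0 p1 r - piE p0 p1 l) * sm (Br l r) p0 p1 n w
      ≤ hi * lv (inL l r) p0 p1 n w := by
  induction n generalizing w u v with
  | zero =>
    have hw : inL l r w := ⟨u, hu.1⟩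
    have huv : lexLe u v := hu.2 v hv.1
    have e1 := hlo u v (Omega_app hu.1) (Omega_app hv.1) huv
    have e2 := hhi u v (Omega_app hu.1) (Omega_app hv.1) huv
    have e3 := Wt_pos h0 h1 w
    rw [lv_zero, sm_zero, fP, if_pos hw]
    constructor <;> nlinarith
  | succ n ih =>
    rw [lv_succ, sm_succ]
    by_cases hb : Br l r w
    · have u0 : u 0 = false := by
        obtain ⟨z, hz⟩ := hb.1
        rw [app_append] at hz
        exact zero_false_of_le (hu.2 _ hz) rfl
      have v0 : v 0 = true := by
        obtain ⟨z, hz⟩ := hb.2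
        rw [app_append] at hz
        exact zero_true_of_le (hv.2 _ hz) rfl
      have i1 := ih (isMn_tl hu u0) (isMx_l hk hb)
      have i2 := ih (isMn_r hk hb) (isMx_tl hv v0)
      rw [Wt_tl_sub h0 h1 u0 hk.l0] at i1
      rw [Wt_tl_sub h0 h1 hk.r0 v0] at i2
      rw [fP, if_pos hb]
      constructor <;> nlinarith [i1.1, i1.2, i2.1, i2.2]
    · have key : ∀ d, u 0 = d → v 0 = d ∧ ¬ inL l r (w ++ [!d]) := by
        intro d hd
        have hL : inL l r (w ++ [d]) := ⟨tl u, (isMn_tl hu hd).1⟩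
        have hn : ¬ inL l r (w ++ [!d]) := by
          intro hc; apply hb; cases d
          · exact ⟨hL, hc⟩
          · exact ⟨hc, hL⟩
        refine ⟨?_, hn⟩
        by_contra hvd
        have hvd' : v 0 = !d := by revert hvd; cases v 0 <;> cases d <;> simp
        exact hn ⟨tl v, (isMx_tl hv hvd').1⟩
      rw [fP, if_neg hb]
      cases hd : u 0 with
      | false =>
        obtain ⟨hv0, hn⟩ := key false hd
        have i1 := ih (isMn_tl hu hd) (isMx_tl hv hv0)
        rw [Wt_tl_sub h0 h1 hd hv0] at i1
        simp only [Bool.not_false] at hn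
        rw [lv_eq_zero hn, sm_eq_zero hn]
        simpa using i1
      | true =>
        obtain ⟨hv0, hn⟩ := key true hd
        have i1 := ih (isMn_tl hu hd) (isMx_tl hv hv0)
        rw [Wt_tl_sub h0 h1 hd hv0] at i1
        simp only [Bool.not_true] at hn
        rw [lv_eq_zero hn, sm_eq_zero hn]
        simpa using i1

lemma allFalse_le (v : ℕ → Bool) : lexLe (fun _ => false) v := by
  rw [← not_lexLt]; rintro ⟨n, _, h⟩; revert h; cases v n <;> simp
lemma le_allTrue (v : ℕ → Bool) : lexLe v (fun _ => true) := by
  rw [← not_lexLt]; rintro ⟨n, _, h⟩; revert h; cases v n <;> simp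

lemma allFalse_mem (a b : ℕ → Bool) : (fun _ => false) ∈ Omega a b :=
  Omega_of fun n => Or.inl (allFalse_le a)
lemma allTrue_mem (a b : ℕ → Bool) : (fun _ => true) ∈ Omega a b :=
  Omega_of fun n => Or.inr (le_allTrue b)

lemma Br_nil (l r : ℕ → Bool) : Br l r [] :=
  ⟨⟨fun _ => false, by
      have := allFalse_mem l r
      rwa [← scons_tl' (u := fun _ => false) (d := false) rfl] at this⟩,
    ⟨fun _ => true, by
      have := allTrue_mem l r
      rwa [← scons_tl' (u := fun _ => true) (d := true) rfl] at this⟩⟩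

lemma kneading_nil {l r : ℕ → Bool} (hk : KN l r) {p0 p1 : ℝ} (h0 : 1 < p0) (h1 : 1 < p1)
    {lo hi : ℝ}
    (hlo : ∀ u v, u ∈ Omega l r → v ∈ Omega l r → lexLe u v → lo ≤ piE p0 p1 v - piE p0 p1 u)
    (hhi : ∀ u v, u ∈ Omega l r → v ∈ Omega l r → lexLe u v → piE p0 p1 v - piE p0 p1 u ≤ hi)
    (n : ℕ) :
    lo * lv (inL l r) p0 p1 n [] ≤ 1 / (p1 - 1)
        - (piE p0 p1 r - piE p0 p1 l) * sm (Br l r) p0 p1 n [] ∧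
    1 / (p1 - 1) - (piE p0 p1 r - piE p0 p1 l) * sm (Br l r) p0 p1 n []
      ≤ hi * lv (inL l r) p0 p1 n [] := by
  have := kneading hk h0 h1 hlo hhi n (w := []) (u := fun _ => false) (v := fun _ => true)
    ⟨allFalse_mem l r, fun v _ => allFalse_le v⟩ ⟨allTrue_mem l r, fun v _ => le_allTrue v⟩
  simpa [piE_allTrue h0 h1, piE_allFalse] using this

lemma one_le_smBr {l r : ℕ → Bool} {p0 p1 : ℝ} (h0 : 1 < p0) (h1 : 1 < p1) (n : ℕ) :
    1 ≤ sm (Br l r) p0 p1 (n + 1) [] := by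
  have := sm_mono h0 h1 (Br l r) (show 1 ≤ n + 1 by omega) []
  rw [sm_succ, sm_zero, sm_zero, fP, if_pos (Br_nil l r)] at this
  simpa using this

/-- The critical sum is finite. -/
def ZB (l r : ℕ → Bool) (p0 p1 : ℝ) : Prop := ∃ C, ∀ n, sm (inL l r) p0 p1 n [] ≤ C

lemma lv_tendsto_zero {l r : ℕ → Bool} {p0 p1 : ℝ} (h0 : 1 < p0) (h1 : 1 < p1)
    (hZ : ZB l r p0 p1) : Tendsto (fun n => lv (inL l r) p0 p1 n []) atTop (𝓝 0) := by
  obtain ⟨C, hC⟩ := hZ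
  exact (summable_of_sum_range_le (fun n => lv_nonneg h0 h1 _ n _) hC).tendsto_atTop_zero

lemma delta_pos {l r : ℕ → Bool} (hk : KN l r) {p0 p1 : ℝ} (h0 : 1 < p0) (h1 : 1 < p1)
    (hZ : ZB l r p0 p1) :
    0 < piE p0 p1 r - piE p0 p1 l ∧
      ∀ n, (piE p0 p1 r - piE p0 p1 l) * sm (Br l r) p0 p1 n [] ≤ 1 / (p1 - 1) := by
  have hp1 : 0 < p1 - 1 := by linarith
  have hc : 0 < 1 / (p1 - 1) := by positivity
  have hlv := lv_tendsto_zero h0 h1 hZ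
  set c := 1 / (p1 - 1) with hcdef
  have kn := kneading_nil hk h0 h1 (lo := -c) (hi := c)
    (fun u v _ _ _ => by
      have a1 := piE_le h0 h1 u; have a2 := piE_nonneg h0 h1 v; linarith)
    (fun u v _ _ _ => by
      have a1 := piE_le h0 h1 v; have a2 := piE_nonneg h0 h1 u; linarith)
  have t1 : Tendsto (fun n => c * lv (inL l r) p0 p1 n []) atTop (𝓝 (c * 0)) :=
    hlv.const_mul c
  rw [mul_zero] at t1
  have hpos : 0 < piE p0 p1 r - piE p0 p1 l := by
    by_contra hcon
    push Not at hcon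
    obtain ⟨n, hn1, hn2⟩ := ((t1.eventually (gt_mem_nhds hc)).and (eventually_ge_atTop 1)).exists
    obtain ⟨m, rfl⟩ : ∃ m, n = m + 1 := ⟨n - 1, by omega⟩
    have h3 := one_le_smBr (l := l) (r := r) h0 h1 m
    have h4 := (kn (m + 1)).2
    nlinarith
  refine ⟨hpos, fun n => ?_⟩
  have t2 : Tendsto (fun n => c + c * lv (inL l r) p0 p1 n []) atTop (𝓝 (c + 0)) :=
    t1.const_add c
  rw [add_zero] at t2
  refine ge_of_tendsto t2 ?_
  filter_upwards [eventually_ge_atTop n] with m hm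
  have h4 := (kn m).1
  have h5 := mul_le_mul_of_nonneg_left (sm_mono h0 h1 (Br l r) hm []) hpos.le
  linarith


/-! ## Part 4 : finiteness of the critical sum -/

/-- All words of length `< n`. -/
def wlt (n : ℕ) : Finset (List Bool) := (Finset.range n).biUnion words

lemma mem_wlt {n : ℕ} {w : List Bool} : w ∈ wlt n ↔ w.length < n := by
  simp [wlt, mem_words]

open Classical in
lemma sm_eq_filter (P : List Bool → Prop) (p0 p1 : ℝ) (n : ℕ) :
    sm P p0 p1 n [] = ∑ w ∈ (wlt n).filter P, Wt p0 p1 w := by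
  rw [Finset.sum_filter, wlt, Finset.sum_biUnion]
  · rfl
  · intro i _ j _ hij
    simp only [Function.onFun]
    rw [Finset.disjoint_left]
    intro w h1 h2
    rw [mem_words] at h1 h2
    exact hij (h1.symm.trans h2)

lemma sum_image_le_aux {α β : Type*} [DecidableEq β] (s : Finset α) (g : α → β)
    (f : β → ℝ) (hf : ∀ b, 0 ≤ f b) : ∑ b ∈ s.image g, f b ≤ ∑ x ∈ s, f (g x) := by
  classical
  induction s using Finset.induction_on with
  | empty => simp
  | insert x s hx ih =>
    rw [Finset.image_insert, Finset.sum_insert hx]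
    by_cases h : g x ∈ s.image g
    · rw [Finset.insert_eq_of_mem h]; linarith [hf (g x)]
    · rw [Finset.sum_insert h]; linarith

lemma inL_decomp {l r : ℕ → Bool} (hk : KN l r) {w : List Bool} (h : inL l r w) :
    ∃ (u : List Bool) (k : ℕ) (d : Bool), Br l r u ∧ u.length + k = w.length ∧ w = u ++ pre (if d then r else l) k := by
  induction w using List.reverseRecOn with
  | nil => exact ⟨[], 0, false, Br_nil l r, rfl, rfl⟩
  | append_singleton w d ih =>
    by_cases hb : Br l r w
    · refine ⟨w, 1, d, hb, by simp, ?_⟩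
      cases d <;> simp [pre_succ, hk.l0, hk.r0]
    · obtain ⟨u, k, e, h1, h2, h3⟩ := ih (inL_of_append h)
      set x := if e then r else l with hx
      have hux : app u x ∈ Omega l r := by
        rw [hx]; cases e
        · exact (branch hk h1).1
        · exact (branch hk h1).2
      have hw' : inL l r (w ++ [x k]) := by
        refine ⟨shiftTail x (k + 1), ?_⟩
        rw [h3, List.append_assoc, ← pre_succ', app_append, app_pre]
        exact hux
      have hd : d = x k := by
        by_contra hne
        apply hb
        have hd' : x k = !d := by revert hne; cases x k <;> cases d <;> simp
        rw [hd'] at hw'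
        cases d
        · exact ⟨h, hw'⟩
        · exact ⟨hw', h⟩
      refine ⟨u, k + 1, e, h1, by simp; omega, ?_⟩
      rw [← hx, pre_succ', ← List.append_assoc, ← h3, hd]

lemma geo_bound {ρ : ℝ} (h0 : 0 ≤ ρ) (h1 : ρ < 1) (n : ℕ) :
    ∑ k ∈ Finset.range n, ρ ^ k ≤ (1 - ρ)⁻¹ := by
  rw [← tsum_geometric_of_lt_one h0 h1]
  exact (summable_geometric_of_lt_one h0 h1).sum_le_tsum _ fun k _ => by positivity

lemma ZB_of_Br {l r : ℕ → Bool} (hk : KN l r) {p0 p1 : ℝ} (h0 : 1 < p0) (h1 : 1 < p1)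
    (h : ∃ C, ∀ n, sm (Br l r) p0 p1 n [] ≤ C) : ZB l r p0 p1 := by
  classical
  obtain ⟨C, hC⟩ := h
  refine ⟨C * (2 * (1 - rho p0 p1)⁻¹), fun n => ?_⟩
  set T := (((wlt n).filter (Br l r)) ×ˢ (Finset.range n)) ×ˢ (Finset.univ : Finset Bool) with hT
  set g : (List Bool × ℕ) × Bool → List Bool :=
    fun x => x.1.1 ++ pre (if x.2 then r else l) x.1.2 with hg
  have hsub : (wlt n).filter (inL l r) ⊆ T.image g := by
    intro w hw
    rw [Finset.mem_filter, mem_wlt] at hw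
    obtain ⟨u, k, d, e1, e2, e3⟩ := inL_decomp hk hw.2
    rw [Finset.mem_image]
    refine ⟨((u, k), d), ?_, e3.symm⟩
    simp only [hT, Finset.mem_product, Finset.mem_filter, mem_wlt, Finset.mem_range,
      Finset.mem_univ, and_true]
    exact ⟨⟨by omega, e1⟩, by omega⟩
  have hρ0 := rho_nonneg (p1 := p1) h0
  have hρ1 := rho_lt h0 h1
  calc sm (inL l r) p0 p1 n [] = ∑ w ∈ (wlt n).filter (inL l r), Wt p0 p1 w := sm_eq_filter _ _ _ _
    _ ≤ ∑ w ∈ T.image g, Wt p0 p1 w :=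
        Finset.sum_le_sum_of_subset_of_nonneg hsub fun w _ _ => (Wt_pos h0 h1 w).le
    _ ≤ ∑ x ∈ T, Wt p0 p1 (g x) := sum_image_le_aux _ _ _ fun w => (Wt_pos h0 h1 w).le
    _ ≤ ∑ x ∈ T, Wt p0 p1 x.1.1 * rho p0 p1 ^ x.1.2 := by
        refine Finset.sum_le_sum fun x _ => ?_
        rw [hg, Wt_append]
        have := Wt_le h0 h1 (pre (if x.2 then r else l) x.1.2)
        rw [pre_length] at this
        exact mul_le_mul_of_nonneg_left this (Wt_pos h0 h1 _).le
    _ = (∑ u ∈ (wlt n).filter (Br l r), Wt p0 p1 u) *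
          (2 * ∑ k ∈ Finset.range n, rho p0 p1 ^ k) := by
        rw [hT, Finset.sum_product, Finset.sum_product]
        simp only [Finset.sum_const, Finset.card_univ, Fintype.card_bool]
        rw [Finset.sum_mul]
        refine Finset.sum_congr rfl fun u _ => ?_
        rw [Finset.mul_sum, Finset.mul_sum]
        refine Finset.sum_congr rfl fun k _ => ?_
        simp; ring
    _ ≤ C * (2 * (1 - rho p0 p1)⁻¹) := by
        rw [← sm_eq_filter]
        have e1 := geo_bound hρ0 hρ1 n
        have e2 : 0 ≤ ∑ k ∈ Finset.range n, rho p0 p1 ^ k :=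
          Finset.sum_nonneg fun k _ => by positivity
        have e3 : 0 ≤ C := by
          have := hC 0; rwa [sm_zero] at this
        exact mul_le_mul (hC n) (by linarith) (by linarith) e3

lemma prefix_of_app_eq {f w : List Bool} {u v : ℕ → Bool} (h : app f v = app w u)
    (hl : f.length ≤ w.length) : ∃ z, w = f ++ z := by
  induction f generalizing w with
  | nil => exact ⟨w, rfl⟩
  | cons d f ih =>
    cases w with
    | nil => simp at hl
    | cons e w =>
      have e1 : d = e := congrFun h 0
      have e2 : app f v = app w u := congrArg tl h
      obtain ⟨z, hz⟩ := ih e2 (by simpa using hl)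
      exact ⟨z, by rw [e1, hz]; rfl⟩

/-- `F` is a finite family of words covering `Omega l r`, of total weight `< 1`. -/
def Cov (l r : ℕ → Bool) (p0 p1 : ℝ) (F : Finset (List Bool)) : Prop :=
  (∑ w ∈ F, Wt p0 p1 w < 1) ∧ ∀ u ∈ Omega l r, ∃ w ∈ F, ∃ v, app w v = u

lemma ZB_of_Cov {l r : ℕ → Bool} {p0 p1 : ℝ} (h0 : 1 < p0) (h1 : 1 < p1)
    {F : Finset (List Bool)} (hF : Cov l r p0 p1 F) : ZB l r p0 p1 := by
  classical
  obtain ⟨hs, hc⟩ := hF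
  set θ := ∑ w ∈ F, Wt p0 p1 w with hθ
  have hθ0 : 0 ≤ θ := Finset.sum_nonneg fun w _ => (Wt_pos h0 h1 w).le
  have hne : ([] : List Bool) ∉ F := by
    intro hm
    have := Finset.single_le_sum (f := fun w => Wt p0 p1 w)
      (fun w _ => (Wt_pos h0 h1 w).le) hm
    simp only [Wt_nil] at this
    linarith
  obtain ⟨N, hN⟩ : ∃ N, ∀ w ∈ F, w.length ≤ N := ⟨F.sup List.length, fun w hw =>
    Finset.le_sup (f := List.length) hw⟩
  set D := ∑ w ∈ wlt N, Wt p0 p1 w with hD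
  have hD0 : 0 ≤ D := Finset.sum_nonneg fun w _ => (Wt_pos h0 h1 w).le
  refine ⟨D / (1 - θ), fun n => ?_⟩
  have h1θ : 0 < 1 - θ := by linarith
  induction n with
  | zero => rw [sm_zero]; positivity
  | succ n ih =>
    have hsub : (wlt (n + 1)).filter (inL l r) ⊆
        wlt N ∪ (F ×ˢ (wlt n).filter (inL l r)).image (fun x => x.1 ++ x.2) := by
      intro w hw
      rw [Finset.mem_filter, mem_wlt] at hw
      rw [Finset.mem_union, mem_wlt]
      by_cases hwN : w.length < N
      · exact Or.inl hwN
      · right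
        obtain ⟨u, hu⟩ := hw.2
        obtain ⟨f, hf, v, hv⟩ := hc _ hu
        obtain ⟨z, rfl⟩ := prefix_of_app_eq hv ((hN f hf).trans (by omega))
        rw [Finset.mem_image]
        refine ⟨(f, z), ?_, rfl⟩
        have hfl : f.length ≠ 0 := by
          intro h0; rw [List.length_eq_zero_iff] at h0; exact hne (h0 ▸ hf)
        have := hw.1
        rw [List.length_append] at this
        simp only [Finset.mem_product, Finset.mem_filter, mem_wlt]
        exact ⟨hf, by omega, inL_of_append_right hw.2⟩
    have hnn : ∀ w, 0 ≤ Wt p0 p1 w := fun w => (Wt_pos h0 h1 w).le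
    have hstep : sm (inL l r) p0 p1 (n + 1) [] ≤ D + θ * sm (inL l r) p0 p1 n [] := by
      rw [sm_eq_filter, sm_eq_filter]
      calc _ ≤ ∑ w ∈ wlt N ∪ (F ×ˢ (wlt n).filter (inL l r)).image (fun x => x.1 ++ x.2),
              Wt p0 p1 w :=
            Finset.sum_le_sum_of_subset_of_nonneg hsub fun w _ _ => hnn w
        _ ≤ D + ∑ w ∈ (F ×ˢ (wlt n).filter (inL l r)).image (fun x => x.1 ++ x.2),
              Wt p0 p1 w := by
            rw [← Finset.sum_union_inter]
            exact le_add_of_nonneg_right (Finset.sum_nonneg fun w _ => hnn w)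
        _ ≤ D + ∑ x ∈ F ×ˢ (wlt n).filter (inL l r), Wt p0 p1 (x.1 ++ x.2) := by
            gcongr; exact sum_image_le_aux _ _ _ hnn
        _ = _ := by
            rw [Finset.sum_product, hθ, Finset.sum_mul]
            simp only [Wt_append, Finset.mul_sum]
    calc _ ≤ D + θ * sm (inL l r) p0 p1 n [] := hstep
      _ ≤ D + θ * (D / (1 - θ)) := by gcongr
      _ = D / (1 - θ) := by field_simp; ring

lemma Cov_of_ZB {l r : ℕ → Bool} {p0 p1 : ℝ} (h0 : 1 < p0) (h1 : 1 < p1)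
    (hZ : ZB l r p0 p1) : ∃ F, Cov l r p0 p1 F := by
  classical
  have ht := lv_tendsto_zero h0 h1 hZ
  obtain ⟨n, hn⟩ := (ht.eventually (gt_mem_nhds one_pos)).exists
  refine ⟨(words n).filter (inL l r), ?_, fun u hu => ?_⟩
  · rw [Finset.sum_filter]; exact hn
  · refine ⟨pre u n, ?_, _, app_pre u n⟩
    rw [Finset.mem_filter, mem_words]
    exact ⟨pre_length u n, shiftTail u n, by rwa [app_pre]⟩

/-- Openness: a finite critical sum stays finite for slightly smaller exponents. -/
lemma ZB_open {l r : ℕ → Bool} {q0 q1 : ℝ} (h0 : 1 < q0) (h1 : 1 < q1) {s : ℝ} (hs : 0 < s)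
    (hZ : ZB l r (q0 ^ s) (q1 ^ s)) : ∃ t, 0 < t ∧ t < s ∧ ZB l r (q0 ^ t) (q1 ^ t) := by
  obtain ⟨F, hF1, hF2⟩ := Cov_of_ZB (Real.one_lt_rpow h0 hs) (Real.one_lt_rpow h1 hs) hZ
  have hcont : ContinuousAt (fun t : ℝ => ∑ w ∈ F, Wt (q0 ^ t) (q1 ^ t) w) s := by
    simp only [Wt_rpow h0 h1]
    refine (continuous_finsetSum _ fun w _ => ?_).continuousAt
    exact Real.continuous_const_rpow (Wt_pos h0 h1 _).ne'
  have hev := hcont.eventually (gt_mem_nhds hF1)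
  obtain ⟨t, ⟨ht1, ht2⟩, ht3⟩ := (Filter.Eventually.and (p := fun t => t ∈ Set.Ioo 0 s) (Ioo_mem_nhdsLT hs)
    (hev.filter_mono nhdsWithin_le_nhds)).exists
  exact ⟨t, ht1, ht2, ZB_of_Cov (Real.one_lt_rpow h0 ht1) (Real.one_lt_rpow h1 ht1) ⟨ht3, hF2⟩⟩


/-! ## Part 5 : Hausdorff dimension of `piE '' Omega` -/

/-- The images of the two one-digit cylinders of `Omega l r` are separated. -/
structure SepK (l r : ℕ → Bool) (q0 q1 α β : ℝ) : Prop where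
  lt : α < β
  left : ∀ u ∈ Omega l r, u 0 = false → piE q0 q1 u ≤ α
  right : ∀ u ∈ Omega l r, u 0 = true → β ≤ piE q0 q1 u

lemma SepK.mono {l r : ℕ → Bool} {q0 q1 α β : ℝ} (h : SepK l r q0 q1 α β) (h0 : 1 < q0)
    (h1 : 1 < q1) {u v : ℕ → Bool} (hu : u ∈ Omega l r) (hv : v ∈ Omega l r)
    (huv : lexLe u v) : piE q0 q1 u ≤ piE q0 q1 v := by
  rcases huv with huv | rfl
  · obtain ⟨w, u', v', rfl, rfl, e3, e4⟩ := lexLt_decomp huv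
    have e5 := h.left _ (Omega_app hu) e3
    have e6 := h.right _ (Omega_app hv) e4
    have e7 := piE_app_sub h0 h1 w v' u'
    have e8 : 0 ≤ Wt q0 q1 w * (piE q0 q1 v' - piE q0 q1 u') :=
      mul_nonneg (Wt_pos h0 h1 w).le (by linarith [h.lt])
    linarith
  · exact le_rfl

lemma SepK.gap {l r : ℕ → Bool} {q0 q1 α β : ℝ} (h : SepK l r q0 q1 α β) (h0 : 1 < q0)
    (h1 : 1 < q1) {m : ℕ} {u v : ℕ → Bool} (hu : u ∈ Omega l r) (hv : v ∈ Omega l r)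
    (huv : u m ≠ v m) :
    ∃ k ≤ m, (β - α) * Wt q0 q1 (pre u k) ≤ |piE q0 q1 u - piE q0 q1 v| := by
  induction m generalizing u v with
  | zero =>
    refine ⟨0, le_rfl, ?_⟩
    simp only [pre_zero, Wt_nil, mul_one]
    cases e1 : u 0 <;> cases e2 : v 0 <;> simp only [e1, e2, ne_eq, not_true_eq_false] at huv
    · have := h.left u hu e1; have := h.right v hv e2
      rw [abs_sub_comm]; exact le_trans (by linarith) (le_abs_self _)
    · have := h.right u hu e1; have := h.left v hv e2
      exact le_trans (by linarith) (le_abs_self _)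
  | succ m ih =>
    by_cases e : u 0 = v 0
    · obtain ⟨k, hk, hk2⟩ := ih (Omega_tl hu) (Omega_tl hv) huv
      refine ⟨k + 1, by omega, ?_⟩
      have hq : 0 < (qb q0 q1 (u 0))⁻¹ := by
        have := qb_gt h0 h1 (u 0); positivity
      have e1 : piE q0 q1 u - piE q0 q1 v
          = (qb q0 q1 (u 0))⁻¹ * (piE q0 q1 (tl u) - piE q0 q1 (tl v)) := by
        have := piE_app_sub h0 h1 [u 0] (tl u) (tl v)
        simp only [app_cons, app_nil, Wt_cons, Wt_nil, mul_one, scons_tl, scons_tl' e.symm] at this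
        exact this
      rw [e1, abs_mul, abs_of_pos hq, pre_succ, Wt_cons]
      nlinarith [mul_le_mul_of_nonneg_left hk2 hq.le]
    · refine ⟨0, by omega, ?_⟩
      simp only [pre_zero, Wt_nil, mul_one]
      cases e1 : u 0 <;> cases e2 : v 0 <;> simp only [e1, e2, not_true_eq_false] at e
      · have := h.left u hu e1; have := h.right v hv e2
        rw [abs_sub_comm]; exact le_trans (by linarith) (le_abs_self _)
      · have := h.right u hu e1; have := h.left v hv e2
        exact le_trans (by linarith) (le_abs_self _)

lemma ediam_cyl {q0 q1 : ℝ} (h0 : 1 < q0) (h1 : 1 < q1) (l r : ℕ → Bool) (w : List Bool) :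
    Metric.ediam (piE q0 q1 '' {u | u ∈ Omega l r ∧ ∃ v, app w v = u})
      ≤ ENNReal.ofReal (1 / (q1 - 1) * Wt q0 q1 w) := by
  refine Metric.ediam_le ?_
  rintro _ ⟨u, ⟨_, u', rfl⟩, rfl⟩ _ ⟨v, ⟨_, v', rfl⟩, rfl⟩
  rw [edist_dist, Real.dist_eq]
  apply ENNReal.ofReal_le_ofReal
  rw [piE_app_sub h0 h1, abs_mul, abs_of_pos (Wt_pos h0 h1 w), mul_comm]
  refine mul_le_mul_of_nonneg_right ?_ (Wt_pos h0 h1 w).le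
  have a1 := piE_le h0 h1 u'
  have a2 := piE_le h0 h1 v'
  have a3 := piE_nonneg h0 h1 u'
  have a4 := piE_nonneg h0 h1 v'
  rw [abs_le]; constructor <;> linarith

open MeasureTheory in
lemma dimH_le_of_ZB {l r : ℕ → Bool} {q0 q1 : ℝ} (h0 : 1 < q0) (h1 : 1 < q1) {t : ℝ}
    (ht : 0 < t) (hZ : ZB l r (q0 ^ t) (q1 ^ t)) :
    dimH (piE q0 q1 '' Omega l r) ≤ ENNReal.ofReal t := by
  classical
  obtain ⟨C, hC⟩ := hZ
  have g0 := Real.one_lt_rpow h0 ht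
  have g1 := Real.one_lt_rpow h1 ht
  set c := 1 / (q1 - 1) with hc
  have hc0 : 0 < c := by
    have : 0 < q1 - 1 := by linarith
    positivity
  have hmain : μH[t] (piE q0 q1 '' Omega l r) ≤ ENNReal.ofReal (c ^ t * C) := by
    have := Measure.hausdorffMeasure_le_liminf_sum (β := ℕ)
      (ι := fun n => {w // w ∈ (words n).filter (inL l r)}) t (piE q0 q1 '' Omega l r)
      (l := atTop) (fun n => ENNReal.ofReal (c * rho q0 q1 ^ n))
      (by
        have h := (tendsto_pow_atTop_nhds_zero_of_lt_one (rho_nonneg (p1 := q1) h0)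
          (rho_lt h0 h1)).const_mul c
        rw [mul_zero] at h
        simpa using ENNReal.tendsto_ofReal h)
      (fun n w => piE q0 q1 '' {u | u ∈ Omega l r ∧ ∃ v, app w.1 v = u})
      (Eventually.of_forall fun n w => by
        refine (ediam_cyl h0 h1 l r w.1).trans (ENNReal.ofReal_le_ofReal ?_)
        refine mul_le_mul_of_nonneg_left ?_ hc0.le
        have h2 := Wt_le h0 h1 w.1
        have h3 := mem_words.1 (Finset.mem_filter.1 w.2).1
        rwa [h3] at h2)
      (Eventually.of_forall fun n => by
        rintro _ ⟨u, hu, rfl⟩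
        rw [Set.mem_iUnion]
        refine ⟨⟨pre u n, ?_⟩, u, ⟨hu, _, app_pre u n⟩, rfl⟩
        rw [Finset.mem_filter, mem_words]
        exact ⟨pre_length u n, shiftTail u n, by rwa [app_pre]⟩)
    refine this.trans ?_
    have hb : ∀ n : ℕ, ∑ i : {w // w ∈ (words n).filter (inL l r)},
        Metric.ediam (piE q0 q1 '' {u | u ∈ Omega l r ∧ ∃ v, app i.1 v = u}) ^ t
          ≤ ENNReal.ofReal (c ^ t * C) := by
      intro n
      calc _ ≤ ∑ i : {w // w ∈ (words n).filter (inL l r)},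
              ENNReal.ofReal (c ^ t * Wt (q0 ^ t) (q1 ^ t) i.1) := by
            refine Finset.sum_le_sum fun i _ => ?_
            refine (ENNReal.rpow_le_rpow (ediam_cyl h0 h1 l r i.1) ht.le).trans ?_
            rw [ENNReal.ofReal_rpow_of_nonneg (mul_nonneg hc0.le (Wt_pos h0 h1 _).le) ht.le,
              Real.mul_rpow hc0.le (Wt_pos h0 h1 _).le, Wt_rpow h0 h1]
        _ = ENNReal.ofReal (c ^ t * lv (inL l r) (q0 ^ t) (q1 ^ t) n []) := by
            rw [← ENNReal.ofReal_sum_of_nonneg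
              (fun i _ => mul_nonneg (by positivity) (Wt_pos g0 g1 _).le), ← Finset.mul_sum,
              Finset.sum_coe_sort ((words n).filter (inL l r))
                (fun w => Wt (q0 ^ t) (q1 ^ t) w), Finset.sum_filter]
            rfl
        _ ≤ _ := by
            apply ENNReal.ofReal_le_ofReal
            refine mul_le_mul_of_nonneg_left ?_ (by positivity)
            refine le_trans ?_ (hC (n + 1))
            rw [sm]
            exact Finset.single_le_sum (f := fun k => lv (inL l r) (q0 ^ t) (q1 ^ t) k [])
              (fun k _ => lv_nonneg g0 g1 _ k _) (Finset.mem_range.2 (Nat.lt_succ_self n))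
    exact (liminf_le_liminf (Eventually.of_forall hb)).trans_eq (liminf_const _)
  have hne : μH[((Real.toNNReal t : NNReal) : ℝ)] (piE q0 q1 '' Omega l r) ≠ ⊤ := by
    rw [Real.coe_toNNReal t ht.le]
    exact ne_top_of_le_ne_top ENNReal.ofReal_ne_top hmain
  exact dimH_le_of_hausdorffMeasure_ne_top hne

lemma exists_word_for_set {l r : ℕ → Bool} {q0 q1 α β : ℝ} (h : SepK l r q0 q1 α β) (h0 : 1 < q0)
    (h1 : 1 < q1) {t : ℝ} (ht : 0 < t) (E : Set ℝ) (hE : Metric.ediam E ≤ 1) {η : ℝ}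
    (hη : 0 < η) :
    ∃ w : List Bool, (∀ u ∈ Omega l r, piE q0 q1 u ∈ E → ∃ v, app w v = u) ∧
      ENNReal.ofReal (Wt (q0 ^ t) (q1 ^ t) w) ≤
        ENNReal.ofReal ((β - α)⁻¹ ^ t) * (⨆ _ : E.Nonempty, Metric.ediam E ^ t)
          + ENNReal.ofReal η := by
  have hγ : 0 < β - α := by linarith [h.lt]
  have hdec : ∀ u : ℕ → Bool, ∀ θ : ℝ, 0 < θ → ∃ n, Wt q0 q1 (pre u n) ≤ θ := by
    intro u θ hθ
    obtain ⟨n, hn⟩ := exists_pow_lt_of_lt_one hθ (rho_lt h0 h1)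
    refine ⟨n, (Wt_le h0 h1 _).trans ?_⟩
    rw [pre_length]; exact hn.le
  have hη' : 0 < η ^ t⁻¹ := by positivity
  have hηt : (η ^ t⁻¹) ^ t = η := by
    rw [← Real.rpow_mul hη.le, inv_mul_cancel₀ ht.ne', Real.rpow_one]
  by_cases hne : ∃ u ∈ Omega l r, piE q0 q1 u ∈ E
  · obtain ⟨u, hu, huE⟩ := hne
    set d := (Metric.ediam E).toReal with hd
    have hfin : Metric.ediam E ≠ ⊤ := ne_top_of_le_ne_top ENNReal.one_ne_top hE
    have hd0 : 0 ≤ d := ENNReal.toReal_nonneg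
    set θ := max (d / (β - α)) (η ^ t⁻¹) with hθ
    have hθ0 : 0 < θ := lt_max_of_lt_right hη'
    have hex := hdec u θ hθ0
    classical
    set n := Nat.find hex with hn
    have hn1 : Wt q0 q1 (pre u n) ≤ θ := Nat.find_spec hex
    refine ⟨pre u n, ?_, ?_⟩
    · intro v hv hvE
      rw [app_eq_iff]
      intro m hm
      by_contra hne
      obtain ⟨k, hk, hk2⟩ := h.gap h0 h1 hu hv hne
      have hk3 : ¬ Wt q0 q1 (pre u k) ≤ θ := Nat.find_min hex (by omega)
      push Not at hk3
      have hk4 : d / (β - α) < Wt q0 q1 (pre u k) := lt_of_le_of_lt (le_max_left _ _) hk3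
      rw [div_lt_iff₀ hγ] at hk4
      have hk5 : |piE q0 q1 u - piE q0 q1 v| ≤ d := by
        have := Metric.edist_le_ediam_of_mem huE hvE
        rw [edist_dist, Real.dist_eq] at this
        rw [hd]
        exact (ENNReal.ofReal_le_iff_le_toReal hfin).1 this
      nlinarith
    · have hEne : E.Nonempty := ⟨_, huE⟩
      rw [iSup_pos hEne, Wt_rpow h0 h1]
      have hdt : Metric.ediam E ^ t = ENNReal.ofReal (d ^ t) := by
        rw [← ENNReal.ofReal_rpow_of_nonneg hd0 ht.le, hd, ENNReal.ofReal_toReal hfin]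
      rw [hdt, ← ENNReal.ofReal_mul (by positivity), ← ENNReal.ofReal_add (by positivity) hη.le]
      apply ENNReal.ofReal_le_ofReal
      have e1 : Wt q0 q1 (pre u n) ^ t ≤ θ ^ t :=
        Real.rpow_le_rpow (Wt_pos h0 h1 _).le hn1 ht.le
      refine e1.trans ?_
      have e2 : (d / (β - α)) ^ t = (β - α)⁻¹ ^ t * d ^ t := by
        rw [div_eq_inv_mul, Real.mul_rpow (by positivity) hd0]
      rcases max_choice (d / (β - α)) (η ^ t⁻¹) with e | e
      · rw [hθ, e, e2]; linarith
      · rw [hθ, e, hηt]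
        have : 0 ≤ (β - α)⁻¹ ^ t * d ^ t := by positivity
        linarith
  · push Not at hne
    obtain ⟨n, hn⟩ := hdec l (η ^ t⁻¹) hη'
    refine ⟨pre l n, fun u hu hE => absurd hE (hne u hu), ?_⟩
    refine le_trans ?_ le_add_self
    apply ENNReal.ofReal_le_ofReal
    rw [Wt_rpow h0 h1, ← hηt]
    exact Real.rpow_le_rpow (Wt_pos h0 h1 _).le hn ht.le

open MeasureTheory in
lemma ZB_of_dimH_lt {l r : ℕ → Bool} {q0 q1 α β : ℝ} (h : SepK l r q0 q1 α β) (h0 : 1 < q0)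
    (h1 : 1 < q1) {t : ℝ} (ht : 0 < t)
    (hd : dimH (piE q0 q1 '' Omega l r) < ENNReal.ofReal t) : ZB l r (q0 ^ t) (q1 ^ t) := by
  classical
  have g0 := Real.one_lt_rpow h0 ht
  have g1 := Real.one_lt_rpow h1 ht
  have hγ : 0 < β - α := by linarith [h.lt]
  have hz : μH[t] (piE q0 q1 '' Omega l r) = 0 := by
    have := hausdorffMeasure_of_dimH_lt (s := piE q0 q1 '' Omega l r)
      (d := Real.toNNReal t) hd
    rwa [Real.coe_toNNReal t ht.le] at this
  rw [Measure.hausdorffMeasure_apply] at hz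
  have hz1 : (⨅ (s : ℕ → Set ℝ) (_ : piE q0 q1 '' Omega l r ⊆ ⋃ n, s n)
      (_ : ∀ n, Metric.ediam (s n) ≤ 1), ∑' n, ⨆ _ : (s n).Nonempty, Metric.ediam (s n) ^ t) = 0 :=
    le_antisymm ((le_iSup₂ (f := fun (ρ : ENNReal) (_ : 0 < ρ) =>
      ⨅ (s : ℕ → Set ℝ) (_ : piE q0 q1 '' Omega l r ⊆ ⋃ n, s n)
      (_ : ∀ n, Metric.ediam (s n) ≤ ρ), ∑' n, ⨆ _ : (s n).Nonempty, Metric.ediam (s n) ^ t)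
      1 one_pos).trans_eq hz) bot_le
  set G := ENNReal.ofReal ((β - α)⁻¹ ^ t) with hG
  have hG0 : G ≠ 0 := by
    rw [hG, ne_eq, ENNReal.ofReal_eq_zero, not_le]; positivity
  have hGt : G ≠ ⊤ := ENNReal.ofReal_ne_top
  have hpos : (0 : ENNReal) < G⁻¹ * (1 / 2) :=
    ENNReal.mul_pos (ENNReal.inv_ne_zero.2 hGt) (by simp)
  rw [← hz1] at hpos
  simp only [iInf_lt_iff] at hpos
  obtain ⟨E, hE1, hE2, hE3⟩ := hpos
  obtain ⟨η, hη1, hη2⟩ := ENNReal.exists_pos_sum_of_countable (ε := 1 / 2) (by simp) ℕ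
  have hw := fun n => exists_word_for_set h h0 h1 ht (E n) (hE2 n) (η := η n) (hη1 n)
  choose w hw1 hw2 using hw
  have hsum : ∑' n, ENNReal.ofReal (Wt (q0 ^ t) (q1 ^ t) (w n)) < 1 := by
    calc _ ≤ ∑' n, (G * (⨆ _ : (E n).Nonempty, Metric.ediam (E n) ^ t) + ENNReal.ofReal (η n)) :=
          ENNReal.tsum_le_tsum hw2
      _ = G * (∑' n, ⨆ _ : (E n).Nonempty, Metric.ediam (E n) ^ t) + ∑' n, (η n : ENNReal) := by
          rw [ENNReal.tsum_add, ENNReal.tsum_mul_left]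
          simp
      _ < 1 / 2 + 1 / 2 := by
          refine ENNReal.add_lt_add ?_ hη2
          calc _ < G * (G⁻¹ * (1 / 2)) := ENNReal.mul_lt_mul_right hG0 hGt hE3
            _ = 1 / 2 := by rw [← mul_assoc, ENNReal.mul_inv_cancel hG0 hGt, one_mul]
      _ = 1 := ENNReal.add_halves 1
  have hcomp : IsCompact (Omega l r) := (isClosed_Omega l r).isCompact
  obtain ⟨T, hT⟩ := hcomp.elim_finite_subcover
    (fun n => {u : ℕ → Bool | ∃ v, app (w n) v = u}) (fun n => isOpen_cyl (w n)) (by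
      intro u hu
      obtain ⟨n, hn⟩ := Set.mem_iUnion.1 (hE1 ⟨u, hu, rfl⟩)
      exact Set.mem_iUnion.2 ⟨n, hw1 n u hu hn⟩)
  refine ZB_of_Cov g0 g1 (F := T.image w) ⟨?_, fun u hu => ?_⟩
  · have hnn : ∀ w, 0 ≤ Wt (q0 ^ t) (q1 ^ t) w := fun w => (Wt_pos g0 g1 w).le
    refine lt_of_le_of_lt (sum_image_le_aux _ _ _ hnn) ?_
    have := lt_of_le_of_lt (ENNReal.sum_le_tsum T) hsum
    rw [← ENNReal.ofReal_sum_of_nonneg fun n _ => hnn _] at this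
    exact ENNReal.ofReal_lt_one.1 this
  · obtain ⟨n, hn, v, hv⟩ := Set.mem_iUnion₂.1 (hT hu)
    exact ⟨w n, Finset.mem_image_of_mem w hn, v, hv⟩


/-! ## Part 6 : the critical exponent -/

lemma ZB_one {l r : ℕ → Bool} (hk : KN l r) {q0 q1 α β : ℝ} (h : SepK l r q0 q1 α β)
    (h0 : 1 < q0) (h1 : 1 < q1) : ZB l r q0 q1 := by
  have hp1 : 0 < q1 - 1 := by linarith
  refine ZB_of_Br hk h0 h1 ⟨(1 / (q1 - 1)) / (β - α), fun n => ?_⟩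
  have hγ : 0 < β - α := by linarith [h.lt]
  have hkn := (kneading_nil hk h0 h1 (lo := 0) (hi := 1 / (q1 - 1))
    (fun u v hu hv huv => by linarith [h.mono h0 h1 hu hv huv])
    (fun u v _ _ _ => by linarith [piE_le h0 h1 v, piE_nonneg h0 h1 u]) n).1
  have e1 := h.left l hk.lm hk.l0
  have e2 := h.right r hk.rm hk.r0
  rw [zero_mul] at hkn
  rw [le_div_iff₀ hγ]
  have hs : 0 ≤ sm (Br l r) q0 q1 n [] := by
    have := sm_mono h0 h1 (Br l r) (Nat.zero_le n) []
    rwa [sm_zero] at this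
  nlinarith [mul_le_mul_of_nonneg_left (show β - α ≤ piE q0 q1 r - piE q0 q1 l by linarith) hs]

theorem critical {l r : ℕ → Bool} (hk : KN l r) {q0 q1 α β : ℝ} (h : SepK l r q0 q1 α β)
    (h0 : 1 < q0) (h1 : 1 < q1) (hpos : ∃ t0 : ℝ, 0 < t0 ∧ ¬ ZB l r (q0 ^ t0) (q1 ^ t0)) :
    ∃ s : ℝ, dimH (piE q0 q1 '' Omega l r) = ENNReal.ofReal s ∧ 0 < s ∧ s < 1 ∧
      piE (q0 ^ s) (q1 ^ s) l = piE (q0 ^ s) (q1 ^ s) r ∧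
      (∀ t : ℝ, s < t → piE (q0 ^ t) (q1 ^ t) l ≠ piE (q0 ^ t) (q1 ^ t) r) := by
  classical
  set D := dimH (piE q0 q1 '' Omega l r) with hD
  obtain ⟨t1, ht1, ht1', hZ1⟩ := ZB_open (l := l) (r := r) h0 h1 (s := 1) one_pos
    (by simpa using ZB_one hk h h0 h1)
  have hDt1 : D ≤ ENNReal.ofReal t1 := dimH_le_of_ZB h0 h1 ht1 hZ1
  obtain ⟨t0, ht0, hZ0⟩ := hpos
  have hDt0 : ENNReal.ofReal t0 ≤ D := by
    by_contra hc
    exact hZ0 (ZB_of_dimH_lt h h0 h1 ht0 (not_le.1 hc))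
  have hDfin : D ≠ ⊤ := ne_top_of_le_ne_top ENNReal.ofReal_ne_top hDt1
  set s := D.toReal with hs
  have hDs : D = ENNReal.ofReal s := (ENNReal.ofReal_toReal hDfin).symm
  have hs0 : 0 < s := by
    rw [hDs] at hDt0
    have := (ENNReal.ofReal_le_ofReal_iff ENNReal.toReal_nonneg).1 hDt0
    linarith
  have hs1 : s < 1 := by
    rw [hDs] at hDt1
    have := (ENNReal.ofReal_le_ofReal_iff ht1.le).1 hDt1
    linarith
  have hZt : ∀ t, s < t → ZB l r (q0 ^ t) (q1 ^ t) := fun t ht =>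
    ZB_of_dimH_lt h h0 h1 (by linarith) (by
      rw [← hD, hDs]; exact (ENNReal.ofReal_lt_ofReal_iff (by linarith)).2 ht)
  have hdel : ∀ t, s < t → _ := fun t ht =>
    delta_pos hk (Real.one_lt_rpow h0 (by linarith : 0 < t))
      (Real.one_lt_rpow h1 (by linarith : 0 < t)) (hZt t ht)
  have g0 := Real.one_lt_rpow h0 hs0
  have g1 := Real.one_lt_rpow h1 hs0
  refine ⟨s, hDs, hs0, hs1, ?_, fun t ht => ?_⟩
  · have cont : ContinuousAt
        (fun t : ℝ => piE (q0 ^ t) (q1 ^ t) r - piE (q0 ^ t) (q1 ^ t) l) s :=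
      (continuousAt_piE_rpow h0 h1 hs0 r).sub (continuousAt_piE_rpow h0 h1 hs0 l)
    have hev : ∀ᶠ t in 𝓝[>] s, s < t := self_mem_nhdsWithin
    have hge : 0 ≤ piE (q0 ^ s) (q1 ^ s) r - piE (q0 ^ s) (q1 ^ s) l :=
      ge_of_tendsto (cont.tendsto.mono_left nhdsWithin_le_nhds)
        (hev.mono fun t ht => (hdel t ht).1.le)
    by_contra hne
    have hgt : 0 < piE (q0 ^ s) (q1 ^ s) r - piE (q0 ^ s) (q1 ^ s) l :=
      lt_of_le_of_ne hge fun e => hne (by linarith)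
    have hZs : ZB l r (q0 ^ s) (q1 ^ s) := by
      refine ZB_of_Br hk g0 g1
        ⟨(1 / (q1 ^ s - 1)) / (piE (q0 ^ s) (q1 ^ s) r - piE (q0 ^ s) (q1 ^ s) l), fun n => ?_⟩
      rw [le_div_iff₀ hgt, mul_comm]
      have c2 : ContinuousAt (fun t : ℝ => sm (Br l r) (q0 ^ t) (q1 ^ t) n []) s := by
        simp only [sm_eq_filter, Wt_rpow h0 h1]
        refine (continuous_finsetSum _ fun w _ => ?_).continuousAt
        exact Real.continuous_const_rpow (Wt_pos h0 h1 _).ne'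
      have c3 : ContinuousAt (fun t : ℝ => 1 / (q1 ^ t - 1)) s := by
        refine ContinuousAt.div continuousAt_const ?_ (by linarith)
        exact ((Real.continuous_const_rpow (by linarith)).continuousAt).sub continuousAt_const
      exact le_of_tendsto_of_tendsto ((cont.mul c2).tendsto.mono_left nhdsWithin_le_nhds)
        (c3.tendsto.mono_left nhdsWithin_le_nhds) (hev.mono fun t ht => (hdel t ht).2 n)
    obtain ⟨t, ht, hts, hZ⟩ := ZB_open h0 h1 hs0 hZs
    have := dimH_le_of_ZB h0 h1 ht hZ
    rw [← hD, hDs, ENNReal.ofReal_le_ofReal_iff ht.le] at this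
    linarith
  · have := (hdel t ht).1
    intro e
    linarith

/-! ## Part 7 : from `a, b` to `l, r` -/

lemma Wt_le_rho {q0 q1 : ℝ} (h0 : 1 < q0) (h1 : 1 < q1) {w : List Bool} (hw : w ≠ []) :
    Wt q0 q1 w ≤ rho q0 q1 := by
  refine (Wt_le h0 h1 w).trans ?_
  have : 1 ≤ w.length := List.length_pos_iff.2 hw
  simpa using pow_le_pow_of_le_one (rho_nonneg (p1 := q1) h0) (rho_lt h0 h1).le this

lemma le_of_Omega {q0 q1 : ℝ} (h0 : 1 < q0) (h1 : 1 < q1) {a b : ℕ → Bool}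
    (a0 : a 0 = false) (b0 : b 0 = true) (ha : piE q0 q1 a = 1 / q1) :
    ∀ u ∈ Omega a b, u 0 = false → piE q0 q1 u ≤ 1 / q1 := by
  have key := contraction_bound
    (fun u : {u : ℕ → Bool // u ∈ Omega a b ∧ u 0 = false} => piE q0 q1 u.1 - 1 / q1)
    (rho q0 q1) (rho_nonneg h0) (rho_lt h0 h1)
    ⟨1 / (q1 - 1), fun u => by
      have := piE_le h0 h1 u.1
      have : 0 < 1 / q1 := by positivity
      linarith⟩ (by
    rintro K hK hf ⟨u, hu, u0⟩
    dsimp only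
    rcases Omega_le b0 hu u0 with hlt | rfl
    · obtain ⟨w, u', a', e1, e2, e3, e4⟩ := lexLt_decomp hlt
      have hw : w ≠ [] := by
        rintro rfl
        rw [e2] at a0
        rw [app_nil, e4] at a0
        exact absurd a0 (by simp)
      have hu' : u' ∈ Omega a b := Omega_app (w := w) (by rwa [← e1])
      have e5 := hf ⟨u', hu', e3⟩
      dsimp only at e5
      have e6 := piE_ge_of_true h0 h1 e4
      rw [← ha, e1, e2, piE_app_sub h0 h1]
      calc _ ≤ Wt q0 q1 w * K :=
            mul_le_mul_of_nonneg_left (by linarith) (Wt_pos h0 h1 w).le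
        _ ≤ _ := mul_le_mul_of_nonneg_right (Wt_le_rho h0 h1 hw) hK
    · rw [ha, sub_self]; exact mul_nonneg (rho_nonneg h0) hK)
  intro u hu u0
  have := key ⟨u, hu, u0⟩
  dsimp only at this
  linarith

lemma ge_of_Omega {q0 q1 : ℝ} (h0 : 1 < q0) (h1 : 1 < q1) {a b : ℕ → Bool}
    (a0 : a 0 = false) (b0 : b 0 = true) (hb : piE q0 q1 b = 1 / (q0 * (q1 - 1))) :
    ∀ u ∈ Omega a b, u 0 = true → 1 / (q0 * (q1 - 1)) ≤ piE q0 q1 u := by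
  have key := contraction_bound
    (fun u : {u : ℕ → Bool // u ∈ Omega a b ∧ u 0 = true} => 1 / (q0 * (q1 - 1)) - piE q0 q1 u.1)
    (rho q0 q1) (rho_nonneg h0) (rho_lt h0 h1)
    ⟨1 / (q0 * (q1 - 1)), fun u => by
      have := piE_nonneg h0 h1 u.1
      linarith⟩ (by
    rintro K hK hf ⟨u, hu, u0⟩
    dsimp only
    rcases Omega_ge a0 hu u0 with hlt | rfl
    · obtain ⟨w, b', u', e2, e1, e4, e3⟩ := lexLt_decomp hlt
      have hw : w ≠ [] := by
        rintro rfl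
        rw [e2] at b0
        rw [app_nil, e4] at b0
        exact absurd b0 (by simp)
      have hu' : u' ∈ Omega a b := Omega_app (w := w) (by rwa [← e1])
      have e5 := hf ⟨u', hu', e3⟩
      dsimp only at e5
      have e6 := piE_le_of_false h0 h1 e4
      rw [← hb, e1, e2, piE_app_sub h0 h1]
      calc _ ≤ Wt q0 q1 w * K :=
            mul_le_mul_of_nonneg_left (by linarith) (Wt_pos h0 h1 w).le
        _ ≤ _ := mul_le_mul_of_nonneg_right (Wt_le_rho h0 h1 hw) hK
    · rw [hb, sub_self]; exact mul_nonneg (rho_nonneg h0) hK)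
  intro u hu u0
  have := key ⟨u, hu, u0⟩
  dsimp only at this
  linarith

lemma head_of_quasiGreedy {q0 q1 : ℝ} (h0 : 1 < q0) (h1 : 1 < q1) {a : ℕ → Bool}
    (ha : quasiGreedy q0 q1 (1 / q1) a) : a 0 = false := by
  by_contra hc
  have hc : a 0 = true := by simpa using hc
  have e := ha.1
  rw [← scons_tl' hc, piE_true h0 h1] at e
  have hz : piE q0 q1 (tl a) = 0 := by
    field_simp at e
    linarith
  refine ha.2.1 ⟨1, fun k hk => ?_⟩
  obtain ⟨m, rfl⟩ : ∃ m, k = m + 1 := ⟨k - 1, by omega⟩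
  exact eq_of_piE_zero h0 h1 hz m

lemma head_of_quasiLazy {q0 q1 : ℝ} (h0 : 1 < q0) (h1 : 1 < q1) {b : ℕ → Bool}
    (hb : quasiLazy q0 q1 (1 / (q0 * (q1 - 1))) b) : b 0 = true := by
  by_contra hc
  have hc : b 0 = false := by simpa using hc
  have e := hb.1
  rw [← scons_tl' hc, piE_false h0 h1] at e
  have hz : piE q0 q1 (tl b) = 1 / (q1 - 1) := by
    have : 0 < q1 - 1 := by linarith
    field_simp at e ⊢
    linarith
  refine hb.2.1 ⟨1, fun k hk => ?_⟩
  obtain ⟨m, rfl⟩ : ∃ m, k = m + 1 := ⟨k - 1, by omega⟩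
  exact eq_of_piE_max h0 h1 hz m

lemma Omega_eq {a b l r : ℕ → Bool} (a0 : a 0 = false) (b0 : b 0 = true)
    (hl : isLeftMax a b l) (hr : isRightMin a b r) : Omega l r = Omega a b := by
  have l0 : l 0 = false := zero_false_of_le hl.2.1 a0
  have r0 : r 0 = true := zero_true_of_le hr.2.1 b0
  ext u
  constructor
  · intro hu
    refine Omega_of fun n => ?_
    have := Omega_shift hu n
    cases e : shiftTail u n 0
    · exact Or.inl (lexLe_trans (Omega_le r0 this e) hl.2.1)
    · exact Or.inr (lexLe_trans hr.2.1 (Omega_ge l0 this e))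
  · intro hu
    refine Omega_of fun n => ?_
    have := Omega_shift hu n
    cases e : shiftTail u n 0
    · exact Or.inl (hl.2.2 _ this (Omega_le b0 this e))
    · exact Or.inr (hr.2.2 _ this (Omega_ge a0 this e))

lemma KN_of {a b l r : ℕ → Bool} (a0 : a 0 = false) (b0 : b 0 = true)
    (hl : isLeftMax a b l) (hr : isRightMin a b r) : KN l r :=
  ⟨zero_false_of_le hl.2.1 a0, zero_true_of_le hr.2.1 b0,
    by rw [Omega_eq a0 b0 hl hr]; exact hl.1, by rw [Omega_eq a0 b0 hl hr]; exact hr.1⟩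

lemma gap_lt {q0 q1 : ℝ} (h0 : 1 < q0) (h1 : 1 < q1) (h : q1 < q0 / (q0 - 1)) :
    1 / q1 < 1 / (q0 * (q1 - 1)) := by
  have g0 : 0 < q0 - 1 := by linarith
  have g1 : 0 < q1 - 1 := by linarith
  rw [lt_div_iff₀ g0] at h
  apply one_div_lt_one_div_of_lt (by positivity)
  linarith

lemma SepK_of {q0 q1 : ℝ} (h0 : 1 < q0) (h1 : 1 < q1) (h : q1 < q0 / (q0 - 1))
    {a b : ℕ → Bool} (a0 : a 0 = false) (b0 : b 0 = true) (ha : piE q0 q1 a = 1 / q1)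
    (hb : piE q0 q1 b = 1 / (q0 * (q1 - 1))) :
    SepK a b q0 q1 (1 / q1) (1 / (q0 * (q1 - 1))) :=
  ⟨gap_lt h0 h1 h, le_of_Omega h0 h1 a0 b0 ha, ge_of_Omega h0 h1 a0 b0 hb⟩

/-! ## Part 8 : the univoque set -/

/-- one step of the greedy algorithm -/
noncomputable def gnext (q0 q1 x : ℝ) : ℝ := if 1 / q1 ≤ x then q1 * x - 1 else q0 * x

open Classical in
/-- the greedy expansion -/
noncomputable def gseq (q0 q1 x : ℝ) (n : ℕ) : Bool := decide (1 / q1 ≤ (gnext q0 q1)^[n] x)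

lemma gseq_tl (q0 q1 x : ℝ) : tl (gseq q0 q1 x) = gseq q0 q1 (gnext q0 q1 x) := by
  funext n
  simp [tl, gseq, Function.iterate_succ_apply]

lemma exists_expansion {q0 q1 : ℝ} (h0 : 1 < q0) (h1 : 1 < q1) (h : q0 * q1 ≤ q0 + q1) {x : ℝ}
    (hx0 : 0 ≤ x) (hx1 : x ≤ 1 / (q1 - 1)) : ∃ u, piE q0 q1 u = x := by
  have g1 : 0 < q1 - 1 := by linarith
  have hq1 : 0 < q1 := by linarith
  have hq0 : 0 < q0 := by linarith
  have hstep : ∀ x, 0 ≤ x → x ≤ 1 / (q1 - 1) →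
      0 ≤ gnext q0 q1 x ∧ gnext q0 q1 x ≤ 1 / (q1 - 1) := by
    intro x hx0 hx1
    unfold gnext
    split_ifs with hc
    · rw [div_le_iff₀ hq1] at hc
      refine ⟨by linarith, ?_⟩
      rw [le_div_iff₀ g1] at hx1 ⊢
      nlinarith
    · rw [not_le, lt_div_iff₀ hq1] at hc
      refine ⟨by positivity, ?_⟩
      rw [le_div_iff₀ g1]
      nlinarith
  have key := contraction_bound
    (fun x : {x : ℝ // 0 ≤ x ∧ x ≤ 1 / (q1 - 1)} => |piE q0 q1 (gseq q0 q1 x.1) - x.1|)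
    (rho q0 q1) (rho_nonneg h0) (rho_lt h0 h1)
    ⟨1 / (q1 - 1), fun x => by
      have a1 := piE_le h0 h1 (gseq q0 q1 x.1)
      have a2 := piE_nonneg h0 h1 (gseq q0 q1 x.1)
      have a3 := x.2
      rw [abs_le]; constructor <;> linarith⟩ (by
    rintro K hK hf ⟨x, hx0, hx1⟩
    dsimp only
    have e1 := hf ⟨gnext q0 q1 x, hstep x hx0 hx1⟩
    dsimp only at e1
    have e2 : piE q0 q1 (gseq q0 q1 x) - x = (qb q0 q1 (gseq q0 q1 x 0))⁻¹ *
        (piE q0 q1 (gseq q0 q1 (gnext q0 q1 x)) - gnext q0 q1 x) := by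
      conv_lhs => rw [← scons_tl (gseq q0 q1 x), gseq_tl, piE_scons h0 h1]
      by_cases hc : 1 / q1 ≤ x
      · have : gseq q0 q1 x 0 = true := by simpa [gseq] using hc
        have h2 : gnext q0 q1 x = q1 * x - 1 := if_pos hc
        rw [this]
        simp only [qb, if_true]
        generalize piE q0 q1 (gseq q0 q1 (gnext q0 q1 x)) = y
        rw [h2]
        field_simp
        ring
      · have : gseq q0 q1 x 0 = false := by simpa [gseq] using hc
        have h2 : gnext q0 q1 x = q0 * x := if_neg hc
        rw [this]
        simp only [qb]
        generalize piE q0 q1 (gseq q0 q1 (gnext q0 q1 x)) = y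
        rw [h2]
        simp
        field_simp
    have hpos : 0 < (qb q0 q1 (gseq q0 q1 x 0))⁻¹ := by
      have := qb_gt h0 h1 (gseq q0 q1 x 0)
      positivity
    rw [e2, abs_mul, abs_of_pos hpos]
    exact mul_le_mul (qb_inv_le _) e1 (abs_nonneg _) (rho_nonneg h0))
  refine ⟨gseq q0 q1 x, ?_⟩
  have := key ⟨x, hx0, hx1⟩
  dsimp only at this
  have := abs_eq_zero.1 (le_antisymm this (abs_nonneg _))
  linarith

/-- All tails of `u` avoid the switch region. -/
def Av (q0 q1 : ℝ) (u : ℕ → Bool) : Prop :=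
  ∀ n, (shiftTail u n 0 = false → piE q0 q1 (shiftTail u n) < 1 / q1) ∧
    (shiftTail u n 0 = true → 1 / (q0 * (q1 - 1)) < piE q0 q1 (shiftTail u n))

lemma Av_shift {q0 q1 : ℝ} {u : ℕ → Bool} (h : Av q0 q1 u) (n : ℕ) : Av q0 q1 (shiftTail u n) := by
  intro m
  have : shiftTail (shiftTail u n) m = shiftTail u (n + m) := by
    funext k; simp [shiftTail, add_assoc]
  rw [this]; exact h _

lemma shiftTail_app (w : List Bool) (u : ℕ → Bool) : shiftTail (app w u) w.length = u := by
  have := app_pre (app w u) w.length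
  rw [pre_app] at this
  exact app_inj this

lemma Av_app {q0 q1 : ℝ} {u : ℕ → Bool} {w : List Bool} (h : Av q0 q1 (app w u)) : Av q0 q1 u := by
  have := Av_shift h w.length
  rwa [shiftTail_app] at this

lemma Av.head {q0 q1 : ℝ} {u : ℕ → Bool} (h : Av q0 q1 u) :
    (u 0 = false → piE q0 q1 u < 1 / q1) ∧
    (u 0 = true → 1 / (q0 * (q1 - 1)) < piE q0 q1 u) := by
  simpa using h 0

lemma Av_lt {q0 q1 : ℝ} (h0 : 1 < q0) (h1 : 1 < q1) {u v : ℕ → Bool} (h : Av q0 q1 u)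
    (huv : lexLt u v) : piE q0 q1 u < piE q0 q1 v := by
  obtain ⟨w, u', v', rfl, rfl, e3, e4⟩ := lexLt_decomp huv
  have e5 := (Av_app h).head.1 e3
  have e6 := piE_ge_of_true h0 h1 e4
  have e7 := piE_app_sub h0 h1 w v' u'
  have := mul_pos (Wt_pos h0 h1 w) (show 0 < piE q0 q1 v' - piE q0 q1 u' by linarith)
  linarith

lemma Av_gt {q0 q1 : ℝ} (h0 : 1 < q0) (h1 : 1 < q1) {u v : ℕ → Bool} (h : Av q0 q1 u)
    (huv : lexLt v u) : piE q0 q1 v < piE q0 q1 u := by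
  obtain ⟨w, v', u', rfl, rfl, e3, e4⟩ := lexLt_decomp huv
  have e5 := (Av_app h).head.2 e4
  have e6 := piE_le_of_false h0 h1 e3
  have e7 := piE_app_sub h0 h1 w u' v'
  have := mul_pos (Wt_pos h0 h1 w) (show 0 < piE q0 q1 u' - piE q0 q1 v' by linarith)
  linarith

lemma Av_unique {q0 q1 : ℝ} (h0 : 1 < q0) (h1 : 1 < q1) {u : ℕ → Bool} (h : Av q0 q1 u) :
    piE q0 q1 u ∈ univoque q0 q1 := by
  refine ⟨u, rfl, fun v hv => ?_⟩
  rcases lexLt_trichotomy u v with h2 | h2 | h2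
  · have := Av_lt h0 h1 h h2; dsimp only at hv; linarith
  · exact h2.symm
  · have := Av_gt h0 h1 h h2; dsimp only at hv; linarith

lemma unique_shift {q0 q1 : ℝ} (h0 : 1 < q0) (h1 : 1 < q1) {u : ℕ → Bool}
    (hu : ∀ v, piE q0 q1 v = piE q0 q1 u → v = u) (n : ℕ) :
    ∀ v, piE q0 q1 v = piE q0 q1 (shiftTail u n) → v = shiftTail u n := by
  intro v hv
  have e := piE_app_sub h0 h1 (pre u n) v (shiftTail u n)
  rw [hv, sub_self, mul_zero, app_pre] at e
  have := hu (app (pre u n) v) (by linarith)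
  exact app_inj (w := pre u n) (by rw [this, app_pre])

lemma Av_of_unique {q0 q1 : ℝ} (h0 : 1 < q0) (h1 : 1 < q1) (h : q0 * q1 ≤ q0 + q1)
    {u : ℕ → Bool} (hu : ∀ v, piE q0 q1 v = piE q0 q1 u → v = u) : Av q0 q1 u := by
  intro n
  have hv := unique_shift h0 h1 hu n
  generalize shiftTail u n = v at hv
  have g1 : 0 < q1 - 1 := by linarith
  have hq1 : 0 < q1 := by linarith
  have hq0 : 0 < q0 := by linarith
  constructor
  · intro v0
    by_contra hc
    rw [not_lt] at hc
    have b1 := piE_le h0 h1 v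
    rw [div_le_iff₀ hq1] at hc
    obtain ⟨z, hz⟩ := exists_expansion h0 h1 h (x := q1 * piE q0 q1 v - 1) (by linarith) (by
      rw [le_div_iff₀ g1] at b1 ⊢; nlinarith)
    have := hv (scons true z) (by rw [piE_true h0 h1, hz]; field_simp; ring)
    rw [← this] at v0
    simp at v0
  · intro v0
    by_contra hc
    rw [not_lt] at hc
    have b1 := piE_nonneg h0 h1 v
    obtain ⟨z, hz⟩ := exists_expansion h0 h1 h (x := q0 * piE q0 q1 v) (by positivity) (by
      rw [le_div_iff₀ (by positivity)] at hc ⊢; linarith)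
    have := hv (scons false z) (by rw [piE_false h0 h1, hz]; field_simp)
    rw [← this] at v0
    simp at v0

lemma Av_lt_a {q0 q1 : ℝ} (h0 : 1 < q0) (h1 : 1 < q1) {u a : ℕ → Bool}
    (ha : piE q0 q1 a = 1 / q1) (h : Av q0 q1 u) (u0 : u 0 = false) : lexLt u a := by
  have e := h.head.1 u0
  rcases lexLt_trichotomy u a with h2 | h2 | h2
  · exact h2
  · rw [h2] at e; linarith
  · have := Av_gt h0 h1 h h2; linarith

lemma Av_gt_b {q0 q1 : ℝ} (h0 : 1 < q0) (h1 : 1 < q1) {u b : ℕ → Bool}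
    (hb : piE q0 q1 b = 1 / (q0 * (q1 - 1))) (h : Av q0 q1 u) (u0 : u 0 = true) : lexLt b u := by
  have e := h.head.2 u0
  rcases lexLt_trichotomy u b with h2 | h2 | h2
  · have := Av_lt h0 h1 h h2; linarith
  · rw [h2] at e; linarith
  · exact h2

lemma dimH_univoque {q0 q1 : ℝ} (h0 : 1 < q0) (h1 : 1 < q1) (h : q1 < q0 / (q0 - 1))
    {a b : ℕ → Bool} (a0 : a 0 = false) (b0 : b 0 = true) (ha : piE q0 q1 a = 1 / q1)
    (hb : piE q0 q1 b = 1 / (q0 * (q1 - 1))) :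
    dimH (univoque q0 q1) = dimH (piE q0 q1 '' Omega a b) := by
  have hle : q0 * q1 ≤ q0 + q1 := by
    rw [lt_div_iff₀ (by linarith)] at h; linarith
  have hS := SepK_of h0 h1 h a0 b0 ha hb
  apply le_antisymm
  · refine dimH_mono ?_
    rintro x ⟨u, hu, hu2⟩
    have hA : Av q0 q1 u := Av_of_unique h0 h1 hle fun v hv => hu2 v (hv.trans hu)
    refine ⟨u, Omega_of fun n => ?_, hu⟩
    have hn := Av_shift hA n
    cases e : shiftTail u n 0
    · exact Or.inl (Or.inl (Av_lt_a h0 h1 ha hn e))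
    · exact Or.inr (Or.inl (Av_gt_b h0 h1 hb hn e))
  · set C := Set.range (fun w => piE q0 q1 (app w a)) ∪ Set.range (fun w => piE q0 q1 (app w b))
    have hC : C.Countable := (Set.countable_range _).union (Set.countable_range _)
    have hsub : piE q0 q1 '' Omega a b ⊆ univoque q0 q1 ∪ C := by
      rintro _ ⟨u, hu, rfl⟩
      by_cases hA : Av q0 q1 u
      · exact Or.inl (Av_unique h0 h1 hA)
      · right
        have heq : ∀ n v, piE q0 q1 (shiftTail u n) = piE q0 q1 v →
            piE q0 q1 (app (pre u n) v) = piE q0 q1 u := by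
          intro n v hv
          have e := piE_app_sub h0 h1 (pre u n) (shiftTail u n) v
          rw [hv, sub_self, mul_zero, app_pre] at e
          linarith
        unfold Av at hA
        push Not at hA
        obtain ⟨n, hn⟩ := hA
        have hun := Omega_shift hu n
        cases e : shiftTail u n 0
        · have e1 := hS.left _ hun e
          have e2 : 1 / q1 ≤ piE q0 q1 (shiftTail u n) := by
            by_contra hc
            rw [not_le] at hc
            have := hn fun _ => hc
            rw [e] at this
            exact absurd this.1 (by simp)
          exact Or.inl ⟨pre u n, heq n a (by rw [ha]; exact le_antisymm e1 e2)⟩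
        · have e1 := hS.right _ hun e
          have e2 := (hn (by intro h; rw [e] at h; exact absurd h (by simp))).2
          exact Or.inr ⟨pre u n, heq n b (by rw [hb]; exact le_antisymm e2 e1)⟩
    refine (dimH_mono hsub).trans ?_
    rw [dimH_union, hC.dimH_zero]
    simp

/-! ## Part 9 : uncountable univoque sets -/

lemma Av_all {q0 q1 : ℝ} (h0 : 1 < q0) (h1 : 1 < q1) (h : q0 + q1 < q0 * q1) (u : ℕ → Bool) :
    Av q0 q1 u := by
  have g1 : 0 < q1 - 1 := by linarith
  have key : 1 / (q0 * (q1 - 1)) < 1 / q1 :=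
    one_div_lt_one_div_of_lt (by linarith) (by linarith)
  intro n
  constructor
  · intro e
    exact lt_of_le_of_lt (piE_le_of_false h0 h1 e) key
  · intro e
    exact lt_of_lt_of_le key (piE_ge_of_true h0 h1 e)

lemma piE_inj {q0 q1 : ℝ} (h0 : 1 < q0) (h1 : 1 < q1) {u v : ℕ → Bool} (h : Av q0 q1 u)
    (e : piE q0 q1 u = piE q0 q1 v) : u = v := by
  rcases lexLt_trichotomy u v with h2 | h2 | h2
  · have := Av_lt h0 h1 h h2; linarith
  · exact h2
  · have := Av_gt h0 h1 h h2; linarith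

lemma exists_base {q0 q1 : ℝ} (h0 : 1 < q0) (hK : Kconst q0 < q1) :
    ∃ p, 1 < p ∧ p < q1 ∧ ¬ (univoque q0 p).Countable := by
  have hne : {q1 : ℝ | 1 < q1 ∧ ¬ (univoque q0 q1).Countable}.Nonempty := by
    have g0 : 0 < q0 - 1 := by linarith
    have hQ : 0 < q0 / (q0 - 1) := by positivity
    have h1 : 1 < q0 / (q0 - 1) + 1 := by linarith
    have h2 : q0 + (q0 / (q0 - 1) + 1) < q0 * (q0 / (q0 - 1) + 1) := by
      have : q0 / (q0 - 1) * (q0 - 1) = q0 := div_mul_cancel₀ _ g0.ne'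
      nlinarith
    refine ⟨q0 / (q0 - 1) + 1, h1, fun hc => ?_⟩
    have hinj : Function.Injective (piE q0 (q0 / (q0 - 1) + 1)) := fun u v e =>
      piE_inj h0 h1 (Av_all h0 h1 h2 u) e
    have := hc.preimage_of_injOn (f := piE q0 (q0 / (q0 - 1) + 1)) hinj.injOn
    have h3 : piE q0 (q0 / (q0 - 1) + 1) ⁻¹' univoque q0 (q0 / (q0 - 1) + 1) = Set.univ :=
      Set.eq_univ_of_forall fun u => Av_unique h0 h1 (Av_all h0 h1 h2 u)
    rw [h3, Set.countable_univ_iff] at this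
    obtain ⟨f, hf⟩ := exists_surjective_nat (ℕ → Bool)
    obtain ⟨n, hn⟩ := hf (fun n => !(f n n))
    have h4 := congrFun hn n
    revert h4
    cases f n n <;> simp
  obtain ⟨p, ⟨hp1, hp2⟩, hp3⟩ := exists_lt_of_csInf_lt hne hK
  exact ⟨p, hp1, hp3, hp2⟩

/-! ### condensation points of a shift invariant set -/

/-- elements of `A` with prefix `w` -/
def cylA (A : Set (ℕ → Bool)) (w : List Bool) : Set (ℕ → Bool) := {v | v ∈ A ∧ ∃ y, app w y = v}

/-- condensation points of `A` -/
def Om (A : Set (ℕ → Bool)) : Set (ℕ → Bool) := {u | ∀ n, ¬ (cylA A (pre u n)).Countable}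

lemma not_mem_Om {A : Set (ℕ → Bool)} {u : ℕ → Bool} :
    u ∉ Om A ↔ ∃ w, (cylA A w).Countable ∧ ∃ y, app w y = u := by
  constructor
  · intro h
    simp only [Om, Set.mem_ofPred_eq, not_forall, not_not] at h
    obtain ⟨n, hn⟩ := h
    exact ⟨pre u n, hn, shiftTail u n, app_pre u n⟩
  · rintro ⟨w, hw, y, rfl⟩ h
    apply h w.length
    rwa [pre_app]

lemma isClosed_Om (A : Set (ℕ → Bool)) : IsClosed (Om A) := by
  rw [← isOpen_compl_iff]
  have : (Om A)ᶜ = ⋃ w ∈ {w | (cylA A w).Countable}, {u : ℕ → Bool | ∃ v, app w v = u} := by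
    ext u
    rw [Set.mem_compl_iff, not_mem_Om]
    simp
  rw [this]
  exact isOpen_biUnion fun w _ => isOpen_cyl w

lemma countable_diff_Om (A : Set (ℕ → Bool)) : (A \ Om A).Countable := by
  have : A \ Om A ⊆ ⋃ w ∈ {w | (cylA A w).Countable}, cylA A w := by
    rintro u ⟨hu, hu2⟩
    obtain ⟨w, hw, y, hy⟩ := not_mem_Om.1 hu2
    exact Set.mem_biUnion (x := w) hw ⟨hu, y, hy⟩
  refine Set.Countable.mono this ?_
  exact Set.Countable.biUnion (Set.to_countable _) fun w hw => hw

lemma exists_Om {A : Set (ℕ → Bool)} {w : List Bool} (h : ¬ (cylA A w).Countable)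
    (z : ℕ → Bool) : ∃ u ∈ Om A, u ∈ A ∧ (∃ y, app w y = u) ∧ u ≠ z := by
  by_contra hc
  push Not at hc
  apply h
  refine Set.Countable.mono ?_ ((countable_diff_Om A).union (Set.countable_singleton z))
  rintro v ⟨hv, hv2⟩
  by_cases hO : v ∈ Om A
  · exact Or.inr (hc v hO hv hv2)
  · exact Or.inl ⟨hv, hO⟩

lemma Om_tl {A : Set (ℕ → Bool)} (hA : ∀ u ∈ A, tl u ∈ A) {u : ℕ → Bool} (hu : u ∈ Om A) :
    tl u ∈ Om A := by
  intro n hc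
  apply hu (n + 1)
  refine Set.Countable.mono ?_ (hc.image (scons (u 0)))
  rintro v ⟨hv, y, rfl⟩
  refine ⟨app (pre (tl u) n) y, ⟨?_, y, rfl⟩, ?_⟩
  · have := hA _ hv
    rwa [pre_succ, app_cons, tl_scons] at this
  · rw [pre_succ, app_cons]

lemma Om_shift {A : Set (ℕ → Bool)} (hA : ∀ u ∈ A, tl u ∈ A) {u : ℕ → Bool} (hu : u ∈ Om A)
    (n : ℕ) : shiftTail u n ∈ Om A := by
  induction n generalizing u with
  | zero => simpa using hu
  | succ n ih => rw [shiftTail_succ]; exact ih (Om_tl hA hu)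

lemma cylA_head {A : Set (ℕ → Bool)} (hA : ∀ u ∈ A, tl u ∈ A) (hu : ¬ A.Countable) (d : Bool) :
    ¬ (cylA A [d]).Countable := by
  intro hc
  have hA' : ∀ n, ∀ u ∈ A, shiftTail u n ∈ A := by
    intro n
    induction n with
    | zero => intro u hu; simpa using hu
    | succ n ih => intro u hu; rw [shiftTail_succ]; exact ih _ (hA u hu)
  apply hu
  refine Set.Countable.mono ?_ ((Set.countable_singleton (fun _ : ℕ => !d)).union
    (Set.countable_iUnion fun w : List Bool => hc.image (app w)))
  intro u hu
  by_cases h : ∃ n, u n = d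
  · obtain ⟨n, hn⟩ := h
    right
    refine Set.mem_iUnion.2 ⟨pre u n, shiftTail u n, ⟨hA' n u hu, tl (shiftTail u n), ?_⟩,
      app_pre u n⟩
    rw [app_cons, app_nil]
    exact scons_tl' hn
  · left
    push Not at h
    funext n
    have := h n
    revert this
    cases u n <;> cases d <;> simp

lemma Om_closure {A : Set (ℕ → Bool)} {u : ℕ → Bool} (hu : u ∈ Om A) (F : (ℕ → Bool) → ℝ)
    (hF : Continuous F) (c : ℝ) (h : ∀ v ∈ A, v 0 = u 0 → F v ≤ c) : F u ≤ c := by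
  have hex : ∀ n, ∃ v ∈ A, ∀ m < n + 1, u m = v m := by
    intro n
    obtain ⟨v, -, hv, hv2, -⟩ := exists_Om (hu (n + 1)) (fun _ => true)
    exact ⟨v, hv, (app_eq_iff _ _ _).1 hv2⟩
  choose v hv hv2 using hex
  have ht : Tendsto v atTop (𝓝 u) := by
    rw [tendsto_pi_nhds]
    intro k
    refine tendsto_const_nhds.congr' ?_
    filter_upwards [eventually_ge_atTop k] with n hn
    exact hv2 n k (by omega)
  refine le_of_tendsto ((hF.tendsto u).comp ht) (Eventually.of_forall fun n => ?_)
  exact h _ (hv n) (hv2 n 0 (by omega)).symm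

lemma exists_lexmax {S : Set (ℕ → Bool)} (hS : IsClosed S) (hne : S.Nonempty) :
    ∃ l ∈ S, ∀ u ∈ S, lexLe u l := by
  have h3 : (1 : ℝ) < 3 := by norm_num
  have hA := Av_all h3 h3 (by norm_num)
  obtain ⟨l, hl, hl2⟩ := hS.isCompact.exists_isMaxOn hne (continuous_piE h3 h3).continuousOn
  refine ⟨l, hl, fun u hu => ?_⟩
  rw [← not_lexLt]
  intro hlt
  have := Av_lt h3 h3 (hA l) hlt
  have h4 := hl2 hu
  simp only [Set.mem_ofPred_eq] at h4
  linarith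

lemma exists_lexmin {S : Set (ℕ → Bool)} (hS : IsClosed S) (hne : S.Nonempty) :
    ∃ l ∈ S, ∀ u ∈ S, lexLe l u := by
  have h3 : (1 : ℝ) < 3 := by norm_num
  have hA := Av_all h3 h3 (by norm_num)
  obtain ⟨l, hl, hl2⟩ := hS.isCompact.exists_isMinOn hne (continuous_piE h3 h3).continuousOn
  refine ⟨l, hl, fun u hu => ?_⟩
  rw [← not_lexLt]
  intro hlt
  have := Av_lt h3 h3 (hA u) hlt
  have h4 := hl2 hu
  simp only [Set.mem_ofPred_eq] at h4
  linarith

/-! ### monotonicity in the base -/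

lemma Wt_anti {p0 p1 q0 q1 : ℝ} (h0 : 1 < p0) (h1 : 1 < p1) (h0' : p0 ≤ q0) (h1' : p1 ≤ q1)
    (w : List Bool) : Wt q0 q1 w ≤ Wt p0 p1 w := by
  induction w with
  | nil => simp
  | cons d w ih =>
    rw [Wt_cons, Wt_cons]
    refine mul_le_mul ?_ ih (Wt_pos (by linarith) (by linarith) w).le ?_
    · have : 0 < qb p0 p1 d := by have := qb_gt h0 h1 d; linarith
      apply inv_anti₀ this
      cases d <;> simpa [qb]
    · have := qb_gt h0 h1 d; positivity

lemma piE_anti {p0 p1 q0 q1 : ℝ} (h0 : 1 < p0) (h1 : 1 < p1) (h0' : p0 ≤ q0) (h1' : p1 ≤ q1)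
    (u : ℕ → Bool) : piE q0 q1 u ≤ piE p0 p1 u := by
  rw [piE_eq, piE_eq]
  refine (term_summable (by linarith) (by linarith) u).tsum_le_tsum (fun k => ?_)
    (term_summable h0 h1 u)
  rw [term_eq, term_eq]
  refine mul_le_mul_of_nonneg_left (Wt_anti h0 h1 h0' h1' _) ?_
  split_ifs <;> norm_num

lemma piE_anti' {q0 p q : ℝ} (h0 : 1 < q0) (h1 : 1 < p) (h1' : p ≤ q) (u : ℕ → Bool) :
    piE q0 q u ≤ p / q * piE q0 p u := by
  rw [piE_eq, piE_eq, ← tsum_mul_left]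
  refine (term_summable h0 (by linarith) u).tsum_le_tsum (fun k => ?_)
    ((term_summable h0 h1 u).mul_left _)
  rw [term_eq, term_eq]
  split_ifs with hk
  · rw [pre_succ', hk, Wt_append, Wt_append]
    have h2 := Wt_anti h0 h1 le_rfl h1' (pre u k)
    simp only [Wt_cons, Wt_nil, qb, if_true, mul_one, one_mul]
    have hp : 0 < p := by linarith
    have hq : 0 < q := by linarith
    have : p / q * (Wt q0 p (pre u k) * p⁻¹) = Wt q0 p (pre u k) * q⁻¹ := by field_simp
    rw [this]
    exact mul_le_mul_of_nonneg_right h2 (by positivity)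
  · simp

lemma Wt_false (q0 q1 : ℝ) (n : ℕ) : Wt q0 q1 (pre (fun _ => false) n) = (q0⁻¹) ^ n := by
  induction n with
  | zero => simp
  | succ n ih => rw [pre_succ', Wt_append, ih, pow_succ]; simp [qb]

lemma left_strict {q0 p q : ℝ} (h0 : 1 < q0) (h1 : 1 < p) (h1' : p < q) {u : ℕ → Bool}
    (u0 : u 0 = false) (h : piE q0 p u ≤ 1 / p) : piE q0 q u < 1 / q := by
  have hp : 0 < p := by linarith
  have hq : 0 < q := by linarith
  have g1 : 1 < q := by linarith
  rcases allFalse_le u with hlt | rfl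
  · obtain ⟨w, z, v, e1, rfl, e3, e4⟩ := lexLt_decomp hlt
    have hw : w = pre (fun _ => false) w.length := by
      conv_rhs => rw [e1, pre_app]
    have hz : z = fun _ => false := by
      rw [← shiftTail_app w z, ← e1]; rfl
    have hw0 : w.length ≠ 0 := by
      intro h
      rw [List.length_eq_zero_iff] at h
      subst h
      rw [app_nil, e4] at u0
      exact absurd u0 (by simp)
    have hval : ∀ q, 1 < q → piE q0 q (app w v) = (q0⁻¹) ^ w.length * (q⁻¹ * (1 + piE q0 q (tl v))) := by
      intro q hq
      have := piE_app_sub h0 hq w v z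
      rw [← e1, hz, piE_allFalse, sub_zero, sub_zero] at this
      rw [this, hw, Wt_false, ← hw, ← piE_true h0 hq, scons_tl' e4]
    have hlt1 : (q0⁻¹) ^ w.length < 1 :=
      pow_lt_one₀ (by positivity) (inv_lt_one_of_one_lt₀ h0) hw0
    have hpos : 0 < (q0⁻¹) ^ w.length := by positivity
    rw [hval p h1] at h
    rw [hval q g1]
    set c := (q0⁻¹) ^ w.length
    have h5 : c * (1 + piE q0 p (tl v)) ≤ 1 := by
      rw [le_div_iff₀ hp] at h
      have : c * (p⁻¹ * (1 + piE q0 p (tl v))) * p = c * (1 + piE q0 p (tl v)) := by field_simp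
      linarith
    have h6 := piE_anti' h0 h1 h1'.le (tl v)
    have h7 := piE_nonneg h0 h1 (tl v)
    have h8 : c * (1 + piE q0 q (tl v)) < 1 := by
      rcases h7.eq_or_lt with h9 | h9
      · rw [← h9, mul_zero] at h6
        nlinarith
      · have : p / q < 1 := (div_lt_one hq).2 h1'
        have h10 : piE q0 q (tl v) < piE q0 p (tl v) := by nlinarith
        nlinarith
    rw [lt_div_iff₀ hq]
    have : c * (q⁻¹ * (1 + piE q0 q (tl v))) * q = c * (1 + piE q0 q (tl v)) := by field_simp
    linarith
  · rw [piE_allFalse]; positivity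

/-- digitwise reflection -/
def ng (u : ℕ → Bool) : ℕ → Bool := fun n => !(u n)

lemma ng_scons (d : Bool) (u : ℕ → Bool) : ng (scons d u) = scons (!d) (ng u) := by
  funext n; cases n <;> rfl

lemma reflect {q0 q1 : ℝ} (h0 : 1 < q0) (h1 : 1 < q1) (u : ℕ → Bool) :
    (q1 - 1) * piE q0 q1 u + (q0 - 1) * piE q1 q0 (ng u) = 1 := by
  have g0 : 0 < q0 - 1 := by linarith
  have g1 : 0 < q1 - 1 := by linarith
  have key := contraction_bound
    (fun u : ℕ → Bool => |(q1 - 1) * piE q0 q1 u + (q0 - 1) * piE q1 q0 (ng u) - 1|)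
    (rho q0 q1) (rho_nonneg h0) (rho_lt h0 h1)
    ⟨2, fun u => by
      have a1 := piE_le h0 h1 u
      have a2 := piE_nonneg h0 h1 u
      have a3 := piE_le h1 h0 (ng u)
      have a4 := piE_nonneg h1 h0 (ng u)
      rw [le_div_iff₀ g1] at a1
      rw [le_div_iff₀ g0] at a3
      rw [abs_le]; constructor <;> nlinarith⟩ (by
    intro K hK hf u
    have e2 : (q1 - 1) * piE q0 q1 u + (q0 - 1) * piE q1 q0 (ng u) - 1
        = (qb q0 q1 (u 0))⁻¹ *
          ((q1 - 1) * piE q0 q1 (tl u) + (q0 - 1) * piE q1 q0 (ng (tl u)) - 1) := by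
      conv_lhs => rw [← scons_tl u, ng_scons, piE_scons h0 h1, piE_scons h1 h0]
      have hq1 : 0 < q1 := by linarith
      have hq0 : 0 < q0 := by linarith
      generalize piE q0 q1 (tl u) = y
      generalize piE q1 q0 (ng (tl u)) = y'
      cases u 0 <;> simp [qb] <;> field_simp <;> ring
    have hpos : 0 < (qb q0 q1 (u 0))⁻¹ := by
      have := qb_gt h0 h1 (u 0)
      positivity
    rw [e2, abs_mul, abs_of_pos hpos]
    exact mul_le_mul (qb_inv_le _) (hf (tl u)) (abs_nonneg _) (rho_nonneg h0))
  have := abs_eq_zero.1 (le_antisymm (key u) (abs_nonneg _))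
  linarith

lemma right_strict {q0 p q : ℝ} (h0 : 1 < q0) (h1 : 1 < p) (h1' : p < q) {u : ℕ → Bool}
    (u0 : u 0 = true) (h : 1 / (q0 * (p - 1)) ≤ piE q0 p u) :
    1 / (q0 * (q - 1)) < piE q0 q u := by
  have g1 : 1 < q := by linarith
  have hp : 0 < p - 1 := by linarith
  have hq : 0 < q - 1 := by linarith
  have hq0 : 0 < q0 := by linarith
  have g0 : 0 < q0 - 1 := by linarith
  have r1 := reflect h0 h1 u
  have r2 := reflect h0 g1 u
  have v0 : ng u 0 = false := by simp [ng, u0]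
  rw [div_le_iff₀ (by positivity)] at h
  have h2 : q0 * piE p q0 (ng u) ≤ 1 := by nlinarith
  have h3 : q0 * piE q q0 (ng u) < 1 := by
    rw [← scons_tl' v0, piE_false g1 h0]
    rw [← scons_tl' v0, piE_false h1 h0] at h2
    have h4 := piE_anti h1 h0 h1'.le le_rfl (tl (ng u))
    have h5 := piE_nonneg h1 h0 (tl (ng u))
    have h6 : q⁻¹ < p⁻¹ := inv_strictAnti₀ (by linarith) h1'
    have h7 : 0 < q⁻¹ := by positivity
    rcases h5.eq_or_lt with h9 | h9
    · rw [← h9] at h4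
      have : q⁻¹ * piE q q0 (tl (ng u)) ≤ 0 := mul_nonpos_of_nonneg_of_nonpos h7.le h4
      nlinarith
    · have : q⁻¹ * piE q q0 (tl (ng u)) < p⁻¹ * piE p q0 (tl (ng u)) := by
        calc _ ≤ q⁻¹ * piE p q0 (tl (ng u)) := mul_le_mul_of_nonneg_left h4 h7.le
          _ < _ := mul_lt_mul_of_pos_right h6 h9
      nlinarith
  rw [div_lt_iff₀ (by positivity)]
  nlinarith

/-! ## Part 10 : positivity of the dimension -/

lemma lt_of_agree {l a v z : ℕ → Bool} {n : ℕ} (h1 : ∀ m, m < n → l m = a m) (h2 : l n < a n)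
    (hv : lexLe v l) (hz : ∀ m ≤ n, z m = v m) : lexLt z a := by
  rcases hv with ⟨m, h3, h4⟩ | rfl
  · rcases lt_trichotomy m n with h | rfl | h
    · refine ⟨m, fun i hi => ?_, ?_⟩
      · rw [hz i (by omega), h3 i hi, h1 i (by omega)]
      · rw [hz m (by omega), ← h1 m h]; exact h4
    · refine ⟨m, fun i hi => ?_, ?_⟩
      · rw [hz i (by omega), h3 i hi, h1 i (by omega)]
      · rw [hz m le_rfl]; exact h4.trans h2
    · refine ⟨n, fun i hi => ?_, ?_⟩
      · rw [hz i (by omega), h3 i (by omega), h1 i (by omega)]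
      · rw [hz n le_rfl, h3 n h]; exact h2
  · refine ⟨n, fun i hi => ?_, ?_⟩
    · rw [hz i (by omega), h1 i (by omega)]
    · rw [hz n le_rfl]; exact h2

lemma gt_of_agree {r b v z : ℕ → Bool} {n : ℕ} (h1 : ∀ m, m < n → b m = r m) (h2 : b n < r n)
    (hv : lexLe r v) (hz : ∀ m ≤ n, z m = v m) : lexLt b z := by
  rcases hv with ⟨m, h3, h4⟩ | rfl
  · rcases lt_trichotomy m n with h | rfl | h
    · refine ⟨m, fun i hi => ?_, ?_⟩
      · rw [hz i (by omega), ← h3 i hi, h1 i (by omega)]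
      · rw [hz m (by omega), h1 m h]; exact h4
    · refine ⟨m, fun i hi => ?_, ?_⟩
      · rw [hz i (by omega), ← h3 i hi, h1 i (by omega)]
      · rw [hz m le_rfl]; exact h2.trans h4
    · refine ⟨n, fun i hi => ?_, ?_⟩
      · rw [hz i (by omega), ← h3 i (by omega), h1 i (by omega)]
      · rw [hz n le_rfl, ← h3 n h]; exact h2
  · refine ⟨n, fun i hi => ?_, ?_⟩
    · rw [hz i (by omega), h1 i (by omega)]
    · rw [hz n le_rfl]; exact h2

lemma app_agree {N : ℕ} {z e : ℕ → Bool} (h : ∀ m ≤ N, z m = e m) (y : List Bool) :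
    ∀ m ≤ N, app y z m = app y e m := by
  induction y with
  | nil => exact h
  | cons d y ih =>
    intro m hm
    rw [app_cons, app_cons]
    cases m with
    | zero => rfl
    | succ m => exact ih m (by omega)

/-- sequences in `Omega a b` that agree with `l` or `r` up to `N` -/
def Good (a b l r : ℕ → Bool) (N : ℕ) (z : ℕ → Bool) : Prop :=
  z ∈ Omega a b ∧ ((∀ m ≤ N, z m = l m) ∨ (∀ m ≤ N, z m = r m))

lemma Good_app_mem {a b l r : ℕ → Bool} (hk : KN l r) {N na nb : ℕ} (hna : na ≤ N) (hnb : nb ≤ N)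
    (ha1 : ∀ m, m < na → l m = a m) (ha2 : l na < a na)
    (hb1 : ∀ m, m < nb → b m = r m) (hb2 : b nb < r nb)
    {z : ℕ → Bool} (hz : Good a b l r N z) {y : List Bool} (hl : app y l ∈ Omega l r)
    (hr : app y r ∈ Omega l r) : app y z ∈ Omega a b := by
  induction y with
  | nil => exact hz.1
  | cons d y ih =>
    have hlt : app y l ∈ Omega l r := Omega_app (w := [d]) hl
    have hrt : app y r ∈ Omega l r := Omega_app (w := [d]) hr
    have main : ∀ v, v ∈ Omega l r → (∀ m ≤ N, app (d :: y) z m = v m) →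
        ¬ (lexLt a (app (d :: y) z) ∧ lexLt (app (d :: y) z) b) := by
      rintro v hv hag ⟨c1, c2⟩
      cases e : v 0
      · exact lexLt_irrefl (lexLt_trans c1
          (lt_of_agree ha1 ha2 (Omega_le hk.r0 hv e) fun m hm => hag m (by omega)))
      · exact lexLt_irrefl (lexLt_trans c2
          (gt_of_agree hb1 hb2 (Omega_ge hk.l0 hv e) fun m hm => hag m (by omega)))
    rw [app_cons, Omega_scons]
    refine ⟨?_, ih hlt hrt⟩
    rcases hz.2 with h | h
    · exact main _ hl (app_agree h _)
    · exact main _ hr (app_agree h _)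

/-- concatenations of `n` copies of `w` and `x` -/
def conc (w x : List Bool) : ℕ → Finset (List Bool)
  | 0 => {[]}
  | n + 1 => (conc w x n).image (w ++ ·) ∪ (conc w x n).image (x ++ ·)

lemma conc_sum {w x : List Bool} (w0 : w.head? = some false) (x0 : x.head? = some true)
    (p0 p1 : ℝ) (n : ℕ) :
    ∑ c ∈ conc w x n, Wt p0 p1 c = (Wt p0 p1 w + Wt p0 p1 x) ^ n := by
  induction n with
  | zero => simp [conc]
  | succ n ih =>
    rw [conc, Finset.sum_union, Finset.sum_image, Finset.sum_image]
    · simp only [Wt_append]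
      rw [← Finset.mul_sum, ← Finset.mul_sum, ih]
      ring
    · intro c _ d _ h; simpa using h
    · intro c _ d _ h; simpa using h
    · rw [Finset.disjoint_left]
      intro c h1 h2
      obtain ⟨c1, _, rfl⟩ := Finset.mem_image.1 h1
      obtain ⟨c2, _, h3⟩ := Finset.mem_image.1 h2
      have := congrArg List.head? h3
      simp [List.head?_append, w0, x0] at this

lemma conc_length {w x : List Bool} (hw : w ≠ []) (hx : x ≠ []) (n : ℕ) :
    ∀ c ∈ conc w x n, n ≤ c.length ∧ c.length ≤ n * (w.length + x.length) := by
  have hw : 1 ≤ w.length := List.length_pos_iff.2 hw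
  have hx : 1 ≤ x.length := List.length_pos_iff.2 hx
  induction n with
  | zero => simp [conc]
  | succ n ih =>
    intro c hc
    rw [conc, Finset.mem_union, Finset.mem_image, Finset.mem_image] at hc
    rw [add_mul, one_mul]
    rcases hc with ⟨d, hd, rfl⟩ | ⟨d, hd, rfl⟩
    · have := ih d hd
      rw [List.length_append]; omega
    · have := ih d hd
      rw [List.length_append]; omega

lemma not_ZB_of_conc {a b : ℕ → Bool} {w x : List Bool} (w0 : w.head? = some false)
    (x0 : x.head? = some true) (hin : ∀ n, ∀ c ∈ conc w x n, inL a b c) {p0 p1 : ℝ}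
    (h0 : 1 < p0) (h1 : 1 < p1) (hs : 1 ≤ Wt p0 p1 w + Wt p0 p1 x) : ¬ ZB a b p0 p1 := by
  classical
  rintro ⟨C, hC⟩
  have hw : w ≠ [] := by rintro rfl; simp at w0
  have hx : x ≠ [] := by rintro rfl; simp at x0
  have step : ∀ n, ∃ N, sm (inL a b) p0 p1 n [] + 1 ≤ sm (inL a b) p0 p1 N [] := by
    intro n
    refine ⟨max n (n * (w.length + x.length) + 1), ?_⟩
    set N := max n (n * (w.length + x.length) + 1) with hN
    have hsum : 1 ≤ ∑ c ∈ conc w x n, Wt p0 p1 c := by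
      rw [conc_sum w0 x0]; exact one_le_pow₀ hs
    rw [sm_eq_filter, sm_eq_filter]
    have hdis : Disjoint ((wlt n).filter (inL a b)) (conc w x n) := by
      rw [Finset.disjoint_left]
      intro c h1 h2
      have := mem_wlt.1 (Finset.mem_filter.1 h1).1
      have := (conc_length hw hx n c h2).1
      omega
    have hsub : (wlt n).filter (inL a b) ∪ conc w x n ⊆ (wlt N).filter (inL a b) := by
      intro c hc
      rw [Finset.mem_union] at hc
      rw [Finset.mem_filter, mem_wlt]
      rcases hc with hc | hc
      · rw [Finset.mem_filter, mem_wlt] at hc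
        exact ⟨lt_of_lt_of_le hc.1 (le_max_left _ _), hc.2⟩
      · refine ⟨?_, hin n c hc⟩
        have := (conc_length hw hx n c hc).2
        exact lt_of_lt_of_le (by omega) (le_max_right n (n * (w.length + x.length) + 1))
    calc _ ≤ ∑ c ∈ (wlt n).filter (inL a b), Wt p0 p1 c + ∑ c ∈ conc w x n, Wt p0 p1 c := by
          linarith
      _ = ∑ c ∈ (wlt n).filter (inL a b) ∪ conc w x n, Wt p0 p1 c :=
          (Finset.sum_union hdis).symm
      _ ≤ _ := Finset.sum_le_sum_of_subset_of_nonneg hsub fun c _ _ => (Wt_pos h0 h1 c).le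
  have hall : ∀ k : ℕ, ∃ N, (k : ℝ) ≤ sm (inL a b) p0 p1 N [] := by
    intro k
    induction k with
    | zero => exact ⟨0, by simp [sm_zero]⟩
    | succ k ih =>
      obtain ⟨n, hn⟩ := ih
      obtain ⟨N, hN⟩ := step n
      exact ⟨N, by push_cast; linarith⟩
  obtain ⟨k, hk⟩ := exists_nat_gt C
  obtain ⟨N, hN⟩ := hall k
  linarith [hC N]

lemma pre_head (u : ℕ → Bool) {n : ℕ} (hn : n ≠ 0) : (pre u n).head? = some (u 0) := by
  cases n with
  | zero => exact absurd rfl hn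
  | succ n => simp [pre_succ]

/-- long branching prefixes of an extremal condensation point -/
lemma exists_branch {l r : ℕ → Bool} {A : Set (ℕ → Bool)} (hsub : Om A ⊆ Omega l r) {e : ℕ → Bool}
    (he : e ∈ Om A) (n : ℕ) : ∃ m, n ≤ m ∧ Br l r (pre e m) := by
  obtain ⟨u, hu, -, hu2, hne⟩ := exists_Om (he n) e
  rw [app_eq_iff] at hu2
  obtain ⟨w, u', e', rfl, rfl, h3⟩ := ne_decomp hne
  refine ⟨w.length, ?_, ?_⟩
  · by_contra hc
    rw [not_le] at hc
    have := hu2 _ hc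
    have g : ∀ y : ℕ → Bool, app w y w.length = y 0 := fun y => by
      have := congrFun (shiftTail_app w y) 0
      simpa [shiftTail] using this
    rw [g, g] at this
    exact h3 this.symm
  · rw [pre_app]
    have h4 : ∀ y, app w y ∈ Omega l r → inL l r (w ++ [y 0]) := by
      intro y hy
      refine ⟨tl y, ?_⟩
      rw [app_append, app_cons, app_nil, scons_tl]
      exact hy
    have i1 := h4 u' (hsub hu)
    have i2 := h4 e' (hsub he)
    cases c1 : u' 0 <;> cases c2 : e' 0 <;> simp only [c1, c2, ne_eq, not_true_eq_false] at h3 i1 i2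
    · exact ⟨i1, i2⟩
    · exact ⟨i2, i1⟩

lemma exists_not_ZB {q0 q1 : ℝ} (h0 : 1 < q0) (h1 : 1 < q1) (hK : Kconst q0 < q1)
    (h : q1 < q0 / (q0 - 1)) {a b : ℕ → Bool} (ha : piE q0 q1 a = 1 / q1)
    (hb : piE q0 q1 b = 1 / (q0 * (q1 - 1))) :
    ∃ t0 : ℝ, 0 < t0 ∧ ¬ ZB a b (q0 ^ t0) (q1 ^ t0) := by
  obtain ⟨p, hp1, hpq, hunc⟩ := exists_base h0 hK
  have hle : q0 * p ≤ q0 + p := by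
    rw [lt_div_iff₀ (by linarith)] at h
    nlinarith
  set A : Set (ℕ → Bool) := {u | Av q0 p u} with hA
  have hAtl : ∀ u ∈ A, tl u ∈ A := by
    intro u hu
    exact Av_app (w := [u 0]) (by rw [app_cons, app_nil, scons_tl]; exact hu)
  have hAunc : ¬ A.Countable := by
    intro hc
    apply hunc
    refine (hc.image (piE q0 p)).mono ?_
    rintro x ⟨u, hu, hu2⟩
    exact ⟨u, Av_of_unique h0 hp1 hle fun v hv => hu2 v (hv.trans hu), hu⟩
  have hAv : ∀ u ∈ Om A, Av q0 q1 u := by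
    intro u hu n
    have hn := Om_shift hAtl hu n
    constructor
    · intro e
      refine left_strict h0 hp1 hpq e ?_
      refine Om_closure hn _ (continuous_piE h0 hp1) _ fun v hv hv0 => ?_
      exact (Av.head hv).1 (hv0.trans e) |>.le
    · intro e
      refine right_strict h0 hp1 hpq e ?_
      have := Om_closure hn (fun v => - piE q0 p v) (continuous_piE h0 hp1).neg
        (- (1 / (q0 * (p - 1)))) fun v hv hv0 => by
          have := (Av.head hv).2 (hv0.trans e)
          linarith
      linarith
  have hcl : ∀ d : Bool, IsClosed (Om A ∩ {u | u 0 = d}) := fun d =>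
    (isClosed_Om A).inter (isClosed_eq (continuous_apply 0) continuous_const)
  have hne : ∀ d : Bool, (Om A ∩ {u | u 0 = d}).Nonempty := by
    intro d
    obtain ⟨u, hu, -, ⟨y, rfl⟩, -⟩ := exists_Om (cylA_head hAtl hAunc d) (fun _ => true)
    exact ⟨_, hu, rfl⟩
  obtain ⟨l, ⟨hl, l0⟩, hlmax⟩ := exists_lexmax (hcl false) (hne false)
  obtain ⟨r, ⟨hr, r0⟩, hrmin⟩ := exists_lexmin (hcl true) (hne true)
  have hsub : Om A ⊆ Omega l r := by
    intro u hu
    refine Omega_of fun n => ?_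
    have hn := Om_shift hAtl hu n
    cases e : shiftTail u n 0
    · exact Or.inl (hlmax _ ⟨hn, e⟩)
    · exact Or.inr (hrmin _ ⟨hn, e⟩)
  have hk : KN l r := ⟨l0, r0, hsub hl, hsub hr⟩
  obtain ⟨na, ha1, ha2⟩ := Av_lt_a h0 h1 ha (hAv l hl) l0
  obtain ⟨nb, hb1, hb2⟩ := Av_gt_b h0 h1 hb (hAv r hr) r0
  set N := max na nb
  have hna : na ≤ N := le_max_left _ _
  have hnb : nb ≤ N := le_max_right _ _
  obtain ⟨mw, hmw, hbw⟩ := exists_branch hsub hl (N + 1)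
  obtain ⟨mx, hmx, hbx⟩ := exists_branch hsub hr (N + 1)
  have sw := branch hk hbw
  have sx := branch hk hbx
  have hG : ∀ n, ∀ c ∈ conc (pre l mw) (pre r mx) n, Good a b l r N (app c l) := by
    intro n
    induction n with
    | zero =>
      intro c hc
      rw [conc, Finset.mem_singleton] at hc
      subst hc
      refine ⟨Omega_of fun n => ?_, Or.inl fun m _ => rfl⟩
      have hn := Om_shift hAtl hl n
      cases e : shiftTail l n 0
      · exact Or.inl (Or.inl (Av_lt_a h0 h1 ha (hAv _ hn) e))
      · exact Or.inr (Or.inl (Av_gt_b h0 h1 hb (hAv _ hn) e))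
    | succ n ih =>
      intro c hc
      rw [conc, Finset.mem_union, Finset.mem_image, Finset.mem_image] at hc
      rcases hc with ⟨d, hd, rfl⟩ | ⟨d, hd, rfl⟩
      · rw [app_append]
        refine ⟨Good_app_mem hk hna hnb ha1 ha2 hb1 hb2 (ih d hd) sw.1 sw.2, Or.inl fun m hm => ?_⟩
        exact ((app_eq_iff mw l _).1 ⟨_, rfl⟩ m (by omega)).symm
      · rw [app_append]
        refine ⟨Good_app_mem hk hna hnb ha1 ha2 hb1 hb2 (ih d hd) sx.1 sx.2, Or.inr fun m hm => ?_⟩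
        exact ((app_eq_iff mx r _).1 ⟨_, rfl⟩ m (by omega)).symm
  have hcont : ContinuousAt (fun t : ℝ => Wt q0 q1 (pre l mw) ^ t + Wt q0 q1 (pre r mx) ^ t) 0 :=
    ((Real.continuous_const_rpow (Wt_pos h0 h1 _).ne').add
      (Real.continuous_const_rpow (Wt_pos h0 h1 _).ne')).continuousAt
  have hev : ∀ᶠ t in 𝓝[>] (0 : ℝ), 1 < Wt q0 q1 (pre l mw) ^ t + Wt q0 q1 (pre r mx) ^ t := by
    refine (hcont.tendsto.mono_left nhdsWithin_le_nhds).eventually_const_lt ?_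
    simp
  have hpos : ∀ᶠ t in 𝓝[>] (0 : ℝ), 0 < t := self_mem_nhdsWithin
  obtain ⟨t, ht1, ht2⟩ := (hev.and hpos).exists
  refine ⟨t, ht2, ?_⟩
  refine not_ZB_of_conc (w := pre l mw) (x := pre r mx) ?_ ?_
    (fun n c hc => ⟨l, (hG n c hc).1⟩) (Real.one_lt_rpow h0 ht2) (Real.one_lt_rpow h1 ht2) ?_
  · rw [pre_head l (by omega), l0]
  · rw [pre_head r (by omega), r0]
  · rw [Wt_rpow h0 h1, Wt_rpow h0 h1]; exact ht1.le

theorem stmt4_core (q0 q1 : ℝ) (hq0 : 1 < q0) (hq1 : 1 < q1)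
    (hK : Kconst q0 < q1) (hq1' : q1 < q0 / (q0 - 1))
    (a b l r : ℕ → Bool)
    (ha : quasiGreedy q0 q1 (1 / q1) a)
    (hb : quasiLazy q0 q1 (1 / (q0 * (q1 - 1))) b)
    (hl : isLeftMax a b l) (hr : isRightMin a b r) :
    ∃ s : ℝ, dimH (univoque q0 q1) = ENNReal.ofReal s ∧ 0 < s ∧ s < 1 ∧
      piE (q0 ^ s) (q1 ^ s) l = piE (q0 ^ s) (q1 ^ s) r ∧
      (∀ t : ℝ, s < t → piE (q0 ^ t) (q1 ^ t) l ≠ piE (q0 ^ t) (q1 ^ t) r) := by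
  have a0 := head_of_quasiGreedy hq0 hq1 ha
  have b0 := head_of_quasiLazy hq0 hq1 hb
  have hΩ := Omega_eq a0 b0 hl hr
  have hk := KN_of a0 b0 hl hr
  have hS := SepK_of hq0 hq1 hq1' a0 b0 ha.1 hb.1
  have hS' : SepK l r q0 q1 (1 / q1) (1 / (q0 * (q1 - 1))) :=
    ⟨hS.lt, by rw [hΩ]; exact hS.left, by rw [hΩ]; exact hS.right⟩
  rw [dimH_univoque hq0 hq1 hq1' a0 b0 ha.1 hb.1, ← hΩ]
  refine critical hk hS' hq0 hq1 ?_
  obtain ⟨t, ht, hZ⟩ := exists_not_ZB hq0 hq1 hK hq1' ha.1 hb.1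
  have hin : inL l r = inL a b := by
    funext w; simp only [inL, hΩ]
  refine ⟨t, ht, ?_⟩
  unfold ZB at hZ ⊢
  rwa [hin]

/-- Theorem 1(ii): for `𝒦(q₀) < q₁ < q₀/(q₀−1)`, the dimension `s = dim_H 𝒰_{q₀,q₁}`
satisfies `0 < s < 1` and is the maximal root of `π_{q₀^s,q₁^s}(ℓ) = π_{q₀^s,q₁^s}(r)`,
where `ℓ = ℓ_{a,b}`, `r = r_{a,b}` for the quasi-greedy expansion `a` of `1/q₁` and the
quasi-lazy expansion `b` of `1/(q₀(q₁−1))`; if moreover `a, b ∈ Ω_{a,b}`, then `s` is the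
maximal root of `π_{q₀^s,q₁^s}(a) = π_{q₀^s,q₁^s}(b)`. -/
theorem stmt4 (q0 q1 : ℝ) (hq0 : 1 < q0) (hq1 : 1 < q1)
    (hK : Kconst q0 < q1) (hq1' : q1 < q0 / (q0 - 1))
    (a b l r : ℕ → Bool)
    (ha : quasiGreedy q0 q1 (1 / q1) a)
    (hb : quasiLazy q0 q1 (1 / (q0 * (q1 - 1))) b)
    (hl : isLeftMax a b l) (hr : isRightMin a b r) :
    ∃ s : ℝ, dimH (univoque q0 q1) = ENNReal.ofReal s ∧ 0 < s ∧ s < 1 ∧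
      piE (q0 ^ s) (q1 ^ s) l = piE (q0 ^ s) (q1 ^ s) r ∧
      (∀ t : ℝ, s < t → piE (q0 ^ t) (q1 ^ t) l ≠ piE (q0 ^ t) (q1 ^ t) r) ∧
      (a ∈ Omega a b → b ∈ Omega a b →
        piE (q0 ^ s) (q1 ^ s) a = piE (q0 ^ s) (q1 ^ s) b ∧
        ∀ t : ℝ, s < t → piE (q0 ^ t) (q1 ^ t) a ≠ piE (q0 ^ t) (q1 ^ t) b) := by
  obtain ⟨s, h1, h2, h3, h4, h5⟩ := stmt4_core q0 q1 hq0 hq1 hK hq1' a b l r ha hb hl hr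
  refine ⟨s, h1, h2, h3, h4, h5, fun haΩ hbΩ => ?_⟩
  have e1 : a = l := lexLe_antisymm (hl.2.2 a haΩ (lexLe_refl a)) hl.2.1
  have e2 : b = r := lexLe_antisymm hr.2.1 (hr.2.2 b hbΩ (lexLe_refl b))
  subst e1
  subst e2
  exact ⟨h4, h5⟩
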